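/- arXiv:1905.04396 — 5 statements merged into one kernel-verified Lean document; each statement's English description precedes it below -/
import Mathlib

section
/- Let μ be a nonnegative weighting function on ℝ^p, α ∈ (0,1), and for each class k ∈ {1,…,K} let F_k be the distribution of x from class k. Suppose for each k the set A_k ⊆ ℝ^p minimizes ∫ 1_{x∈A} μ(x) dx over all measurable sets A satisfying P_{F_k}(x ∈ A) ≥ 1−α (problem P_k). Then the set-valued map C(x) = {k : x ∈ A_k} minimizes ∫ |C(x)| μ(x) dx over all measurable set-valued maps C : ℝ^p → subsets of {1,…,K} satisfying P_{F_k}(k ∈ C(x)) ≥ 1−α for all k = 1,…,K (problem P), where |C(x)| denotes the cardinality of C(x). -/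
open MeasureTheory
open scoped ENNReal

/-- `lowerQ α g F` is the lower `α` percentile `Q(α; g, F) = sup {t : P_F(g(x) ≤ t) ≤ α}`. -/
noncomputable def lowerQ {X : Type*} [MeasurableSpace X] (α : ℝ) (g : X → ℝ)
    (F : MeasureTheory.Measure X) : ℝ :=
  sSup {t : ℝ | (F {x | g x ≤ t}).toReal ≤ α}

lemma lintegral_ncard_mul (p K : ℕ)
    (μ : (Fin p → ℝ) → ℝ≥0∞) (hμ : Measurable μ)
    (C : (Fin p → ℝ) → Set (Fin K)) (hC : ∀ k, MeasurableSet {x | k ∈ C x}) :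
    ∫⁻ x, (((C x).ncard : ℝ≥0∞)) * μ x = ∑ k, ∫⁻ x in {x | k ∈ C x}, μ x := by
  classical
  have h : ∀ x, (((C x).ncard : ℝ≥0∞)) * μ x = ∑ k, {x | k ∈ C x}.indicator μ x := by
    intro x
    rw [Set.ncard_eq_toFinset_card']
    simp only [Set.indicator_apply, Set.mem_setOf_eq]
    rw [← Finset.sum_filter, Finset.sum_const, nsmul_eq_mul]
    congr 3
    ext k
    simp
  simp_rw [h]
  rw [lintegral_finsetSum _ (fun k _ => hμ.indicator (hC k))]
  exact Finset.sum_congr rfl fun k _ => lintegral_indicator (hC k) _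

/-- if each `A k` solves problem `P_k` (it minimizes `∫_A μ` among measurable
sets with class-`k` coverage at least `1 - α`), then the prediction set
`C₀(x) = {k : x ∈ A k}` minimizes `∫ |C(x)| μ(x) dx` among all measurable prediction sets
`C` with `P_{F_k}(k ∈ C(x)) ≥ 1 - α` for every `k` (problem `P`). -/
theorem oracle_prediction_set_optimal (p K : ℕ)
    (μ : (Fin p → ℝ) → ℝ≥0∞) (hμ : Measurable μ)
    (α : ℝ) (hα : α ∈ Set.Ioo (0 : ℝ) 1)
    (F : Fin K → Measure (Fin p → ℝ)) [∀ k, IsProbabilityMeasure (F k)]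
    (A : Fin K → Set (Fin p → ℝ))
    (hAmeas : ∀ k, MeasurableSet (A k))
    (hAcov : ∀ k, ENNReal.ofReal (1 - α) ≤ F k (A k))
    (hAopt : ∀ k, ∀ A' : Set (Fin p → ℝ), MeasurableSet A' →
      ENNReal.ofReal (1 - α) ≤ F k A' →
      ∫⁻ x in A k, μ x ≤ ∫⁻ x in A', μ x) :
    (∀ k, ENNReal.ofReal (1 - α) ≤ F k {x | k ∈ {k' | x ∈ A k'}}) ∧
      ∀ C : (Fin p → ℝ) → Set (Fin K),
        (∀ k, MeasurableSet {x | k ∈ C x}) →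
        (∀ k, ENNReal.ofReal (1 - α) ≤ F k {x | k ∈ C x}) →
        ∫⁻ x, (({k | x ∈ A k}.ncard : ℝ≥0∞)) * μ x ≤
          ∫⁻ x, (((C x).ncard : ℝ≥0∞)) * μ x := by
  refine ⟨hAcov, fun C hC hcov => ?_⟩
  rw [lintegral_ncard_mul p K μ hμ (fun x => {k | x ∈ A k}) hAmeas,
    lintegral_ncard_mul p K μ hμ C hC]
  exact Finset.sum_le_sum fun k _ => hAopt k _ (hC k) (hcov k)
end

section
/- Fix a class k with density f_k and distribution F_k on ℝ^p, a weighting function μ that is a strictly positive density on ℝ^p, and α ∈ (0,1). Let v_k(x) = f_k(x)/μ(x) and q = Q(α; v_k, F_k), and assume P_{F_k}(v_k(x) = q) = 0. Then the set A_k = {x : v_k(x) ≥ q} satisfies P_{F_k}(x ∈ A_k) ≥ 1−α, and for any measurable set A with P_{F_k}(x ∈ A) ≥ 1−α one has ∫_{A_k} μ(x) dx ≤ ∫_A μ(x) dx; that is, A_k solves problem P_k. -/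
open MeasureTheory
open scoped ENNReal

/-- with `v_k = f_k/μ` and `q = Q(α; v_k, F_k)`, assuming no `F_k`-atom at
level `q`, the set `A_k = {x : v_k(x) ≥ q}` has class-`k` coverage at least `1 - α` and
minimizes `∫_A μ(x) dx` among measurable sets with coverage at least `1 - α`;
that is, `A_k` solves problem `P_k`. -/
theorem density_ratio_set_solves_Pk (p : ℕ)
    (f μ : (Fin p → ℝ) → ℝ)
    (hfmeas : Measurable f) (hf0 : ∀ x, 0 ≤ f x)
    (hμmeas : Measurable μ) (hμpos : ∀ x, 0 < μ x)
    (hμdens : ∫⁻ x, ENNReal.ofReal (μ x) = 1)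
    (F : Measure (Fin p → ℝ))
    (hF : F = MeasureTheory.volume.withDensity fun x => ENNReal.ofReal (f x))
    (hFprob : IsProbabilityMeasure F)
    (α : ℝ) (hα : α ∈ Set.Ioo (0 : ℝ) 1)
    (v : (Fin p → ℝ) → ℝ) (hv : ∀ x, v x = f x / μ x)
    (q : ℝ) (hq : q = lowerQ α v F)
    (hnoatom : F {x | v x = q} = 0) :
    ENNReal.ofReal (1 - α) ≤ F {x | q ≤ v x} ∧
      ∀ A : Set (Fin p → ℝ), MeasurableSet A → ENNReal.ofReal (1 - α) ≤ F A →
        ∫⁻ x in {x | q ≤ v x}, ENNReal.ofReal (μ x) ≤ ∫⁻ x in A, ENNReal.ofReal (μ x) := by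
  have hvm : Measurable v := by
    have : v = fun x => f x / μ x := funext hv
    rw [this]; exact hfmeas.div hμmeas
  have hv0 : ∀ x, 0 ≤ v x := fun x => by rw [hv]; exact div_nonneg (hf0 x) (hμpos x).le
  haveI : IsProbabilityMeasure (F.map v) := Measure.isProbabilityMeasure_map hvm.aemeasurable
  set c := ProbabilityTheory.cdf (F.map v) with hc
  have hcF : ∀ t, c t = (F {x | v x ≤ t}).toReal := by
    intro t
    rw [hc, ProbabilityTheory.cdf_eq_real, Measure.real, Measure.map_apply hvm measurableSet_Iic]
    rfl
  have hq' : q = sSup {t : ℝ | c t ≤ α} := by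
    rw [hq, lowerQ]; simp only [hcF]
  have hneg : ∀ t < 0, c t = 0 := by
    intro t ht
    have : {x | v x ≤ t} = ∅ := by
      ext x; simp only [Set.mem_setOf_eq, Set.mem_empty_iff_false, iff_false, not_le]
      exact ht.trans_le (hv0 x)
    rw [hcF, this]; simp
  have hne : Set.Nonempty {t : ℝ | c t ≤ α} := ⟨-1, by
    simp only [Set.mem_setOf_eq]; rw [hneg (-1) (by norm_num)]; exact hα.1.le⟩
  have hmono : Monotone c := ProbabilityTheory.monotone_cdf _
  have hbdd : BddAbove {t : ℝ | c t ≤ α} := by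
    obtain ⟨T, hT⟩ := ((ProbabilityTheory.tendsto_cdf_atTop (F.map v)).eventually
      (lt_mem_nhds hα.2)).exists
    refine ⟨T, fun t ht => ?_⟩
    by_contra! h
    exact absurd (hT.trans_le (hmono h.le)) (not_lt.mpr ht)
  have hlt : ∀ t < q, c t ≤ α := by
    intro t ht
    rw [hq'] at ht
    obtain ⟨s, hs, hts⟩ := exists_lt_of_lt_csSup hne ht
    exact (hmono hts.le).trans hs
  have hgt : ∀ t, q < t → α ≤ c t := by
    intro t ht
    by_contra! h
    have : t ≤ q := by rw [hq']; exact le_csSup hbdd h.le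
    linarith
  have hge : α ≤ c q := by
    have h1 : Filter.Tendsto c (nhdsWithin q (Set.Ioi q)) (nhds (c q)) :=
      ((c.right_continuous q).mono Set.Ioi_subset_Ici_self)
    refine ge_of_tendsto h1 ?_
    filter_upwards [self_mem_nhdsWithin] with t ht using hgt t ht
  have hle : c q ≤ α := by
    have h1 : Function.leftLim c q ≤ α := by
      refine le_of_tendsto (hmono.tendsto_leftLim q) ?_
      filter_upwards [self_mem_nhdsWithin] with t ht using hlt t ht
    have h2 : c.measure {q} = 0 := by
      rw [hc, ProbabilityTheory.measure_cdf, Measure.map_apply hvm (measurableSet_singleton q)]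
      exact hnoatom
    rw [StieltjesFunction.measure_singleton, ENNReal.ofReal_eq_zero] at h2
    linarith
  have hcq : c q = α := le_antisymm hle hge
  have hqpos : 0 < q := by
    by_contra! h
    rcases h.lt_or_eq with h | h
    · have := hneg q h
      linarith [hα.1]
    · have h1 : {x | v x ≤ q} = {x | v x = q} := by
        ext x
        simp only [Set.mem_setOf_eq]
        exact ⟨fun hx => le_antisymm hx (h ▸ hv0 x), fun hx => hx.le⟩
      have := hcF q
      rw [h1, hnoatom] at this
      simp at this
      linarith [hα.1]
  have hBm : MeasurableSet {x | q ≤ v x} := measurableSet_le measurable_const hvm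
  have hFB : F {x | q ≤ v x} = ENNReal.ofReal (1 - α) := by
    have h1 : {x | q ≤ v x} = {x | v x ≤ q}ᶜ ∪ {x | v x = q} := by
      ext x
      simp only [Set.mem_setOf_eq, Set.mem_union, Set.mem_compl_iff, not_le]
      rw [le_iff_lt_or_eq, eq_comm]
    rw [h1, measure_congr (union_ae_eq_left_of_ae_eq_empty (ae_eq_empty.mpr hnoatom)),
      prob_compl_eq_one_sub (measurableSet_le hvm measurable_const),
      ENNReal.ofReal_sub _ hα.1.le, ENNReal.ofReal_one, ← hcq, hcF,
      ENNReal.ofReal_toReal (measure_ne_top _ _)]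
  refine ⟨hFB.ge, fun A hA hFA => ?_⟩
  set B := {x | q ≤ v x} with hB
  have hdiff : F (B \ A) ≤ F (A \ B) := by
    have e1 := measure_inter_add_diff (μ := F) B hA
    have e2 := measure_inter_add_diff (μ := F) A hBm
    rw [Set.inter_comm] at e2
    rw [← hFB, ← e1, ← e2] at hFA
    exact (ENNReal.add_le_add_iff_left (measure_ne_top _ _)).mp hFA
  have hlow : ENNReal.ofReal q * ∫⁻ x in B \ A, ENNReal.ofReal (μ x) ≤ F (B \ A) := by
    rw [hF, withDensity_apply _ (hBm.diff hA), ← lintegral_const_mul _ hμmeas.ennreal_ofReal]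
    refine setLIntegral_mono hfmeas.ennreal_ofReal fun x hx => ?_
    rw [← ENNReal.ofReal_mul hqpos.le]
    apply ENNReal.ofReal_le_ofReal
    have : q ≤ v x := hx.1
    rw [hv, le_div_iff₀ (hμpos x)] at this
    exact this
  have hup : F (A \ B) ≤ ENNReal.ofReal q * ∫⁻ x in A \ B, ENNReal.ofReal (μ x) := by
    rw [hF, withDensity_apply _ (hA.diff hBm), ← lintegral_const_mul _ hμmeas.ennreal_ofReal]
    refine setLIntegral_mono (hμmeas.ennreal_ofReal.const_mul _) fun x hx => ?_
    rw [← ENNReal.ofReal_mul hqpos.le]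
    apply ENNReal.ofReal_le_ofReal
    have : v x < q := not_le.mp hx.2
    rw [hv, div_lt_iff₀ (hμpos x)] at this
    exact this.le
  have hM := (ENNReal.mul_le_mul_iff_right (ENNReal.ofReal_pos.mpr hqpos).ne'
    ENNReal.ofReal_ne_top).mp (hlow.trans (hdiff.trans hup))
  rw [← lintegral_inter_add_diff (fun x => ENNReal.ofReal (μ x)) B hA,
    ← lintegral_inter_add_diff (fun x => ENNReal.ofReal (μ x)) A hBm, Set.inter_comm A B]
  exact add_le_add le_rfl hM
end

section
/- Let σ_1, …, σ_{n+1} be exchangeable real-valued random variables that are almost surely pairwise distinct, and let s_{n+1} = (1/(n+1)) Σ_{j=1}^{n+1} 1_{σ_{n+1} ≥ σ_j}. Then for any α ∈ (0,1), P( s_{n+1} ≥ ⌊(n+1)α⌋/(n+1) ) ≥ 1 − α. -/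
open MeasureTheory
open scoped ENNReal

lemma rank_card_aux {m : ℕ} (x : Fin m → ℝ) (k : ℕ) :
    (Finset.univ.filter fun i => (Finset.univ.filter fun j => x j ≤ x i).card < k).card ≤ k := by
  classical
  rcases (Finset.univ.filter fun i =>
    (Finset.univ.filter fun j => x j ≤ x i).card < k).eq_empty_or_nonempty with h | h
  · rw [h]; simp
  · obtain ⟨i, hi, hmax⟩ := Finset.exists_max_image _ x h
    refine le_trans (Finset.card_le_card ?_) (Finset.mem_filter.1 hi).2.le
    intro j hj
    exact Finset.mem_filter.2 ⟨Finset.mem_univ _, hmax j hj⟩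

lemma rank_meas_aux {m : ℕ} (k : ℕ) (i : Fin m) :
    MeasurableSet {x : Fin m → ℝ | (Finset.univ.filter fun j => x j ≤ x i).card < k} := by
  have : Measurable (fun x : Fin m → ℝ => (Finset.univ.filter fun j => x j ≤ x i).card) := by
    simp only [Finset.card_filter]
    refine Finset.measurable_sum _ fun j _ => ?_
    exact Measurable.ite (measurableSet_le (measurable_pi_apply j) (measurable_pi_apply i))
      measurable_const measurable_const
  exact this (measurableSet_Iio (a := k))

/-- if `σ_1, …, σ_{n+1}` are exchangeable real random variables, almost surely
pairwise distinct, and `s_{n+1} = (1/(n+1)) Σ_j 1_{σ_{n+1} ≥ σ_j}` is the normalized rank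
of the last one, then for every `α ∈ (0,1)`,
`P(s_{n+1} ≥ ⌊(n+1)α⌋/(n+1)) ≥ 1 − α`. -/
theorem normalized_rank_coverage (n : ℕ)
    (Ω : Type*) [MeasurableSpace Ω] (P : Measure Ω) [IsProbabilityMeasure P]
    (σ : Fin (n + 1) → Ω → ℝ) (hσ : ∀ i, Measurable (σ i))
    (hexch : ∀ π : Equiv.Perm (Fin (n + 1)),
      Measure.map (fun ω => fun i => σ (π i) ω) P
        = Measure.map (fun ω => fun i => σ i ω) P)
    (hdist : ∀ᵐ ω ∂P, ∀ i j, i ≠ j → σ i ω ≠ σ j ω)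
    (s : Ω → ℝ)
    (hs : ∀ ω, s ω = (1 / (n + 1 : ℝ)) * ∑ j : Fin (n + 1),
      if σ j ω ≤ σ (Fin.last n) ω then (1 : ℝ) else 0)
    (α : ℝ) (hα : α ∈ Set.Ioo (0 : ℝ) 1) :
    ENNReal.ofReal (1 - α) ≤
      P {ω | ((⌊(n + 1 : ℝ) * α⌋₊ : ℝ) / (n + 1 : ℝ)) ≤ s ω} := by
  classical
  set k := ⌊(n + 1 : ℝ) * α⌋₊ with hk
  let A : Fin (n + 1) → Set (Fin (n + 1) → ℝ) := fun i =>
    {x | (Finset.univ.filter fun j => x j ≤ x i).card < k}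
  let B : Fin (n + 1) → Set Ω := fun i => (fun ω => fun i => σ i ω) ⁻¹' A i
  have hm : Measurable (fun ω => fun i => σ i ω) := measurable_pi_lambda _ hσ
  have hB : ∀ i, MeasurableSet (B i) := fun i => hm (rank_meas_aux k i)
  have heq : ∀ i, P (B i) = P (B (Fin.last n)) := by
    intro i
    have h := congrArg (fun μ => μ (A (Fin.last n))) (hexch (Equiv.swap i (Fin.last n)))
    rw [Measure.map_apply (measurable_pi_lambda _ fun j => hσ _) (rank_meas_aux k _),
      Measure.map_apply hm (rank_meas_aux k _)] at h
    rw [← h]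
    congr 1
    ext ω
    simp only [B, A, Set.mem_preimage, Set.mem_ofPred_eq, Equiv.swap_apply_right]
    have : (Finset.univ.filter fun j => σ j ω ≤ σ i ω).card
        = (Finset.univ.filter fun j => σ (Equiv.swap i (Fin.last n) j) ω ≤ σ i ω).card := by
      simp only [Finset.card_filter]
      exact (Equiv.sum_comp (Equiv.swap i (Fin.last n))
        (fun j => if σ j ω ≤ σ i ω then 1 else 0)).symm
    rw [this]
  have hsum : ∑ i, P (B i) ≤ (k : ℝ≥0∞) := by
    calc ∑ i, P (B i) = ∑ i, ∫⁻ ω, (B i).indicator 1 ω ∂P := by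
          simp only [lintegral_indicator_one (hB _)]
      _ = ∫⁻ ω, ∑ i, (B i).indicator 1 ω ∂P :=
          (lintegral_finsetSum _ fun i _ => measurable_one.indicator (hB i)).symm
      _ ≤ ∫⁻ ω, (k : ℝ≥0∞) ∂P := by
          refine lintegral_mono fun ω => ?_
          have := rank_card_aux (fun i => σ i ω) k
          rw [Finset.card_filter] at this
          have h2 : ((∑ i, if (Finset.univ.filter fun j => σ j ω ≤ σ i ω).card < k
            then 1 else 0 : ℕ) : ℝ≥0∞) ≤ k := by exact_mod_cast this
          push_cast at h2
          refine le_trans (le_of_eq ?_) h2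
          refine Finset.sum_congr rfl fun i _ => ?_
          simp [Set.indicator_apply, B, A]
      _ = k := by simp
  simp only [heq, Finset.sum_const, Finset.card_univ, Fintype.card_fin, nsmul_eq_mul] at hsum
  have hN : (0 : ℝ) < n + 1 := by positivity
  have hr : P.real (B (Fin.last n)) ≤ α := by
    have h1 := ENNReal.toReal_mono (by simp) hsum
    rw [ENNReal.toReal_mul, ENNReal.toReal_natCast, ENNReal.toReal_natCast] at h1
    push_cast at h1
    have h2 : (k : ℝ) ≤ (n + 1) * α := Nat.floor_le (mul_nonneg hN.le hα.1.le)
    exact le_of_mul_le_mul_left (h1.trans h2) hN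
  have hset : {ω | ((k : ℝ) / (n + 1 : ℝ)) ≤ s ω} = (B (Fin.last n))ᶜ := by
    ext ω
    simp only [B, A, Set.mem_ofPred_eq, Set.mem_compl_iff, Set.mem_preimage, not_lt]
    rw [hs, Finset.sum_boole, one_div_mul_eq_div, div_le_div_iff_of_pos_right hN, Nat.cast_le]
  rw [hset, ← ofReal_measureReal, probReal_compl_eq_one_sub (hB _)]
  exact ENNReal.ofReal_le_ofReal (by linarith)
end

section
/- (Theorem 2, consistency of the mixture proportion estimates.) Let η : ℝ^p → ℝ^K be fixed, g_{l,k} the density of η_l(x) in class k, S_l = {t : g_{l,l}(t) ≥ Q(ζ; g_{l,l}∘η_l, F_l)}, P_l = P_{test}(η_l(x) ∈ S_l), and 𝐏_{l,k} = P_{F_k}(η_l(x) ∈ S_l), with Σ = 𝐏ᵀ𝐏. Assume (Assumption 3) each g_{l,k} is bounded and each g_{l,l} is Hölder continuous; (Assumption 4) there exist constants γ, c_1, c_2 > 0 and δ_0 > 0 such that for all l and |δ| ≤ δ_0, c_1|δ|^γ ≤ |P_{F_l}(g_{l,l}(t) ≤ Q(ζ; g_{l,l}∘η_l, F_l) + δ)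 − ζ| ≤ c_2|δ|^γ; and (Assumption 5) P_R(η_l(x) ∈ S_l) = 0 for all l and Σ is invertible with smallest eigenvalue bounded below by a constant c > 0. Let π̂_k be the solutions of the empirical least-squares problem Ĵ(η) in which P_l and 𝐏_{l,k} are replaced by empirical frequencies over estimated level sets Ŝ_l built from Gaussian kernel density estimates with bandwidth h_n → 0, log n/(n h_n) → 0. Then π̂_k → π̃_k in probability as n → ∞, for each k = 1,…,K. -/
open MeasureTheory Filter Matrix
open scoped Classical
open scoped ENNReal

/-- events holding with probability tending to one -/
def HP {Ω : Type*} [MeasurableSpace Ω] (P : Measure Ω) (A : ℕ → Set Ω) : Prop :=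
  Tendsto (fun n => P (A n)ᶜ) atTop (nhds 0)

lemma HP.inter {Ω : Type*} [MeasurableSpace Ω] {P : Measure Ω} {A B : ℕ → Set Ω}
    (hA : HP P A) (hB : HP P B) : HP P (fun n => A n ∩ B n) := by
  unfold HP at *
  have h := hA.add hB
  rw [add_zero] at h
  refine tendsto_of_tendsto_of_tendsto_of_le_of_le tendsto_const_nhds h (fun _ => zero_le) ?_
  intro n
  dsimp only
  rw [Set.compl_inter]
  exact measure_union_le _ _

lemma HP.mono {Ω : Type*} [MeasurableSpace Ω] {P : Measure Ω} {A B : ℕ → Set Ω}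
    (hA : HP P A) (hB : ∀ᶠ n in atTop, A n ⊆ B n) : HP P B := by
  unfold HP at *
  refine tendsto_of_tendsto_of_tendsto_of_le_of_le' tendsto_const_nhds hA
    (Eventually.of_forall fun _ => zero_le) ?_
  filter_upwards [hB] with n hn
  exact measure_mono (Set.compl_subset_compl.2 hn)

lemma HP.all {Ω : Type*} [MeasurableSpace Ω] {P : Measure Ω} {ι : Type*} [Fintype ι]
    {A : ι → ℕ → Set Ω}
    (hA : ∀ i, HP P (A i)) : HP P (fun n => ⋂ i, A i n) := by
  unfold HP at *
  have h := tendsto_finsetSum Finset.univ (fun i _ => hA i)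
  rw [Finset.sum_const_zero] at h
  refine tendsto_of_tendsto_of_tendsto_of_le_of_le tendsto_const_nhds h (fun _ => zero_le) ?_
  intro n
  dsimp only
  rw [Set.compl_iInter]
  exact measure_iUnion_fintype_le _ _

lemma conc1 {X : Type*} [MeasurableSpace X] {Ω : Type*} [MeasurableSpace Ω] (P : Measure Ω)
    (μ : Measure X) [IsProbabilityMeasure μ] (m : ℕ) (x : ℕ → Ω → X)
    (hx : ∀ i, Measurable (x i))
    (hmap : Measure.map (fun ω => fun i : Fin m => x i ω) P = Measure.pi fun _ : Fin m => μ)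
    (ψ : X → ℝ) (hψ : Measurable ψ) (lam V a : ℝ) (hl : 0 ≤ lam)
    (hb : ∀ y, |lam * ψ y| ≤ 1) (hint : Integrable ψ μ) (hint2 : Integrable (fun y => ψ y ^ 2) μ)
    (h0 : ∫ y, ψ y ∂μ = 0) (hV : ∫ y, ψ y ^ 2 ∂μ ≤ V) :
    P {ω | m * a < ∑ i : Fin m, ψ (x i ω)}
      ≤ ENNReal.ofReal (Real.exp (-(m * (lam * a - lam ^ 2 * V)))) := by
  have hxm : Measurable (fun ω => fun i : Fin m => x i ω) :=
    measurable_pi_lambda _ fun i => hx i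
  have hsm : Measurable (fun y : Fin m → X => ∑ i, ψ (y i)) := by fun_prop
  have e1 : P {ω | m * a < ∑ i : Fin m, ψ (x i ω)}
      = (Measure.pi fun _ : Fin m => μ) {y | m * a < ∑ i, ψ (y i)} := by
    rw [← hmap, Measure.map_apply hxm (measurableSet_lt measurable_const hsm)]
    rfl
  rw [e1]
  have hle1 : ∀ y, Real.exp (lam * ψ y) ≤ Real.exp 1 := fun y =>
    Real.exp_le_exp.2 ((abs_le.1 (hb y)).2)
  have hintexp : Integrable (fun y => Real.exp (lam * ψ y)) μ := by
    refine Integrable.of_bound (C := Real.exp 1) (by fun_prop) (ae_of_all _ fun y => ?_)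
    rw [Real.norm_eq_abs, Real.abs_exp]
    exact hle1 y
  have hE : ∫ y, Real.exp (lam * ψ y) ∂μ ≤ Real.exp (lam ^ 2 * V) := by
    calc ∫ y, Real.exp (lam * ψ y) ∂μ ≤ ∫ y, (1 + lam * ψ y + lam ^ 2 * ψ y ^ 2) ∂μ := by
          refine integral_mono hintexp
            (((integrable_const 1).add (hint.const_mul lam)).add (hint2.const_mul (lam ^ 2))) ?_
          intro y
          have := (abs_le.1 (Real.abs_exp_sub_one_sub_id_le (hb y))).2
          simp only
          nlinarith
      _ = 1 + lam ^ 2 * ∫ y, ψ y ^ 2 ∂μ := by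
          have hA : Integrable (fun y => 1 + lam * ψ y) μ :=
            (integrable_const 1).add (hint.const_mul lam)
          rw [integral_add hA
            (hint2.const_mul (lam ^ 2)), integral_add (integrable_const 1) (hint.const_mul lam),
            integral_const_mul, integral_const_mul, h0]
          simp
      _ ≤ 1 + lam ^ 2 * V := by
          have := mul_le_mul_of_nonneg_left hV (sq_nonneg lam)
          linarith
      _ ≤ Real.exp (lam ^ 2 * V) := by
          have := Real.add_one_le_exp (lam ^ 2 * V)
          linarith
  have hprod : ∫ y, ∏ i : Fin m, Real.exp (lam * ψ (y i)) ∂(Measure.pi fun _ : Fin m => μ)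
      = (∫ y, Real.exp (lam * ψ y) ∂μ) ^ m := by
    have := integral_fintype_prod_eq_pow (ι := Fin m) (𝕜 := ℝ) (fun y => Real.exp (lam * ψ y))
      (μ := μ)
    simpa using this
  have hpi : Integrable (fun y : Fin m → X => ∏ i : Fin m, Real.exp (lam * ψ (y i)))
      (Measure.pi fun _ : Fin m => μ) := by
    refine Integrable.of_bound (C := ∏ i : Fin m, Real.exp 1) ?_ (ae_of_all _ fun y => ?_)
    · apply Measurable.aestronglyMeasurable
      exact Finset.measurable_prod _ (fun i _ => by fun_prop)
    · rw [Real.norm_eq_abs, Finset.abs_prod]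
      refine Finset.prod_le_prod (fun i _ => abs_nonneg _) (fun i _ => ?_)
      rw [Real.abs_exp]
      exact hle1 _
  have hmk := mul_meas_ge_le_integral_of_nonneg
    (ae_of_all _ fun y => Finset.prod_nonneg fun i _ => (Real.exp_pos _).le) hpi
    (Real.exp (lam * (m * a)))
  rw [hprod] at hmk
  have hpow : (∫ y, Real.exp (lam * ψ y) ∂μ) ^ m ≤ Real.exp (m * (lam ^ 2 * V)) := by
    rw [Real.exp_nat_mul]
    exact pow_le_pow_left₀ (integral_nonneg fun y => (Real.exp_pos _).le) hE m
  have hsub : (Measure.pi fun _ : Fin m => μ) {y | m * a < ∑ i, ψ (y i)} ≤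
      (Measure.pi fun _ : Fin m => μ) {y : Fin m → X |
        Real.exp (lam * (m * a)) ≤ ∏ i : Fin m, Real.exp (lam * ψ (y i))} := by
    refine measure_mono fun y hy => ?_
    simp only [Set.mem_ofPred_eq] at hy ⊢
    rw [← Real.exp_sum, ← Finset.mul_sum]
    exact Real.exp_le_exp.2 (mul_le_mul_of_nonneg_left hy.le hl)
  refine hsub.trans ?_
  rw [← ENNReal.ofReal_toReal (measure_ne_top (Measure.pi fun _ : Fin m => μ) _)]
  apply ENNReal.ofReal_le_ofReal
  have h2 := hmk.trans hpow
  have : Real.exp (-(m * (lam * a - lam ^ 2 * V)))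
      = Real.exp (m * (lam ^ 2 * V)) / Real.exp (lam * (m * a)) := by
    rw [← Real.exp_sub]; congr 1; ring
  rw [this, le_div_iff₀ (Real.exp_pos _), mul_comm]
  exact h2

lemma conc {X : Type*} [MeasurableSpace X] {Ω : Type*} [MeasurableSpace Ω] (P : Measure Ω)
    (μ : Measure X) [IsProbabilityMeasure μ] (m : ℕ) (hm : 0 < m) (x : ℕ → Ω → X)
    (hx : ∀ i, Measurable (x i))
    (hmap : Measure.map (fun ω => fun i : Fin m => x i ω) P = Measure.pi fun _ : Fin m => μ)
    (φ : X → ℝ) (hφ : Measurable φ) (lam B V a : ℝ) (hl : 0 ≤ lam)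
    (hB : ∀ y, |φ y| ≤ B) (hlB : lam * (2 * B) ≤ 1) (hV : ∫ y, φ y ^ 2 ∂μ ≤ V) :
    P {ω | a < |(1 / (m : ℝ)) * ∑ i : Fin m, φ (x i ω) - ∫ y, φ y ∂μ|}
      ≤ ENNReal.ofReal (2 * Real.exp (-(m * (lam * a - lam ^ 2 * V)))) := by
  have hint : Integrable φ μ :=
    Integrable.of_bound hφ.aestronglyMeasurable B (ae_of_all _ hB)
  have hint2 : Integrable (fun y => φ y ^ 2) μ := by
    refine Integrable.of_bound (C := B ^ 2) (by fun_prop) (ae_of_all _ fun y => ?_)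
    rw [Real.norm_eq_abs, abs_pow]
    exact pow_le_pow_left₀ (abs_nonneg _) (hB y) 2
  set c := ∫ y, φ y ∂μ with hc
  have hcB : |c| ≤ B := by
    have := norm_integral_le_of_norm_le_const (μ := μ) (f := φ) (C := B) (ae_of_all _ hB)
    simpa using this
  have hmR : (0 : ℝ) < m := by exact_mod_cast hm
  have hdi : Integrable (fun y => φ y - c) μ := hint.sub (integrable_const _)
  have hd2 : Integrable (fun y => (φ y - c) ^ 2) μ := by
    have : (fun y => (φ y - c) ^ 2) = fun y => φ y ^ 2 - 2 * c * φ y + c ^ 2 := by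
      ext y; ring
    rw [this]
    exact (hint2.sub (hint.const_mul _)).add (integrable_const _)
  have hd0 : ∫ y, (φ y - c) ∂μ = 0 := by
    rw [integral_sub hint (integrable_const _)]; simp [hc]
  have hdV : ∫ y, (φ y - c) ^ 2 ∂μ ≤ V := by
    have : (fun y => (φ y - c) ^ 2) = fun y => φ y ^ 2 - 2 * c * φ y + c ^ 2 := by
      ext y; ring
    have hA : Integrable (fun y => φ y ^ 2 - 2 * c * φ y) μ := hint2.sub (hint.const_mul _)
    rw [this, integral_add hA (integrable_const _),
      integral_sub hint2 (hint.const_mul _), integral_const_mul, ← hc]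
    simp
    nlinarith [sq_nonneg c]
  have hbd : ∀ y, |lam * (φ y - c)| ≤ 1 := by
    intro y
    rw [abs_mul, abs_of_nonneg hl]
    refine le_trans (mul_le_mul_of_nonneg_left ?_ hl) hlB
    have := abs_sub (φ y) c
    linarith [hB y]
  have h1 := conc1 P μ m x hx hmap (fun y => φ y - c) (by fun_prop) lam V a hl hbd hdi hd2 hd0 hdV
  have h2 := conc1 P μ m x hx hmap (fun y => -(φ y - c)) (by fun_prop) lam V a hl
    (by intro y; have := hbd y; rwa [mul_neg, abs_neg]) hdi.neg (by simpa only [neg_sq] using hd2)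
    (by rw [integral_neg, hd0, neg_zero]) (by simpa only [neg_sq] using hdV)
  have hsub : {ω | a < |(1 / (m : ℝ)) * ∑ i : Fin m, φ (x i ω) - c|} ⊆
      {ω | m * a < ∑ i : Fin m, (φ (x i ω) - c)} ∪
      {ω | m * a < ∑ i : Fin m, -(φ (x i ω) - c)} := by
    intro ω hω
    simp only [Set.mem_ofPred_eq, Set.mem_union] at hω ⊢
    have e : ∑ i : Fin m, (φ (x i ω) - c)
        = m * ((1 / (m : ℝ)) * ∑ i : Fin m, φ (x i ω) - c) := by
      rw [Finset.sum_sub_distrib]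
      simp
      field_simp
    rw [Finset.sum_neg_distrib, e]
    rcases lt_abs.1 hω with h | h
    · left; exact mul_lt_mul_of_pos_left h hmR
    · right; rw [← mul_neg]; exact mul_lt_mul_of_pos_left h hmR
  refine (measure_mono hsub).trans ((measure_union_le _ _).trans ?_)
  refine (add_le_add h1 h2).trans ?_
  rw [← ENNReal.ofReal_add (Real.exp_pos _).le (Real.exp_pos _).le]
  apply ENNReal.ofReal_le_ofReal
  linarith

/-- empirical frequency -/
noncomputable def emp {X : Type*} (m : ℕ) (x : ℕ → X) (B : Set X) : ℝ :=
  (1 / (m : ℝ)) * ∑ i : Fin m, if x i ∈ B then (1 : ℝ) else 0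

lemma emp_le_add {X : Type*} (m : ℕ) (x : ℕ → X) {A B C : Set X} (h : A ⊆ B ∪ C) :
    emp m x A ≤ emp m x B + emp m x C := by
  unfold emp
  rw [← mul_add, ← Finset.sum_add_distrib]
  refine mul_le_mul_of_nonneg_left (Finset.sum_le_sum fun i _ => ?_) (by positivity)
  by_cases hA : x i ∈ A
  · rcases h hA with hB | hB
    · by_cases hC : x i ∈ C <;> simp [hA, hB, hC]
    · by_cases hC : x i ∈ B <;> simp [hA, hB, hC]
  · simp only [hA, if_false]
    split_ifs <;> norm_num

lemma emp_nonneg {X : Type*} (m : ℕ) (x : ℕ → X) (A : Set X) : 0 ≤ emp m x A := by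
  unfold emp
  refine mul_nonneg (by positivity) (Finset.sum_nonneg fun i _ => ?_)
  split_ifs <;> norm_num

lemma emp_empty {X : Type*} (m : ℕ) (x : ℕ → X) : emp m x ∅ = 0 := by
  simp [emp]

lemma emp_mono {X : Type*} (m : ℕ) (x : ℕ → X) {A B : Set X} (h : A ⊆ B) :
    emp m x A ≤ emp m x B := by
  have := emp_le_add m x (A := A) (B := B) (C := ∅) (by simpa using h)
  rwa [emp_empty, add_zero] at this

lemma lln {X : Type*} [MeasurableSpace X] {Ω : Type*} [MeasurableSpace Ω] (P : Measure Ω)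
    (μ : Measure X) [IsProbabilityMeasure μ] (m : ℕ → ℕ) (hm : Tendsto m atTop atTop)
    (x : ℕ → ℕ → Ω → X) (hx : ∀ n i, Measurable (x n i))
    (hmap : ∀ n, Measure.map (fun ω => fun i : Fin (m n) => x n i ω) P
      = Measure.pi fun _ : Fin (m n) => μ)
    (B : Set X) (hB : MeasurableSet B) (τ : ℝ) (hτ : 0 < τ) :
    HP P (fun n => {ω | |emp (m n) (fun i => x n i ω) B - (μ B).toReal| ≤ τ}) := by
  unfold HP
  have key : ∀ lam : ℝ, 0 ≤ lam → lam * 2 ≤ 1 → ∀ n, 0 < m n →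
      P ({ω | |emp (m n) (fun i => x n i ω) B - (μ B).toReal| ≤ τ})ᶜ ≤
        ENNReal.ofReal (2 * Real.exp (-(m n * (lam * τ - lam ^ 2 * 1)))) := by
    intro lam hl0 hl1 n hn
    have hm01 : ∀ y, (if y ∈ B then (1 : ℝ) else 0) = B.indicator (fun _ => 1) y := by
      intro y; simp [Set.indicator_apply]
    have hi : ∫ y, (if y ∈ B then (1 : ℝ) else 0) ∂μ = (μ B).toReal := by
      simp_rw [hm01]
      rw [integral_indicator hB]
      simp [Measure.real]
    have h := conc P μ (m n) hn (x n) (hx n) (hmap n) (fun y => if y ∈ B then (1 : ℝ) else 0)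
      (Measurable.ite hB measurable_const measurable_const) lam 1 1 τ hl0
      (by intro y; split_ifs <;> norm_num) (by linarith)
      (by
        have : ∀ y, (if y ∈ B then (1 : ℝ) else 0) ^ 2 = (if y ∈ B then (1 : ℝ) else 0) := by
          intro y; split_ifs <;> norm_num
        simp_rw [this]
        rw [hi]
        exact ENNReal.toReal_le_of_le_ofReal zero_le_one (by simpa using prob_le_one))
    rw [hi] at h
    refine le_trans (measure_mono ?_) h
    intro ω hω
    simpa [emp] using hω
  obtain ⟨lam, hl0, hl1, hl2⟩ : ∃ lam : ℝ, 0 ≤ lam ∧ lam * 2 ≤ 1 ∧ 0 < lam * τ - lam ^ 2 * 1 := by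
    refine ⟨min (1 / 2) (τ / 2), by positivity, ?_, ?_⟩
    · linarith [min_le_left (1 / 2) (τ / 2)]
    · have h1 := min_le_right (1 / 2) (τ / 2)
      have h2 : 0 < min (1 / 2) (τ / 2) := by positivity
      nlinarith
  have hlim : Tendsto (fun n => ENNReal.ofReal
      (2 * Real.exp (-(m n * (lam * τ - lam ^ 2 * 1))))) atTop (nhds 0) := by
    rw [← ENNReal.ofReal_zero]
    apply ENNReal.tendsto_ofReal
    have : Tendsto (fun n => (m n : ℝ) * (lam * τ - lam ^ 2 * 1)) atTop atTop :=
      (tendsto_natCast_atTop_atTop.comp hm).atTop_mul_const hl2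
    simpa using (Real.tendsto_exp_neg_atTop_nhds_zero.comp this).const_mul 2
  refine tendsto_of_tendsto_of_tendsto_of_le_of_le' tendsto_const_nhds hlim
    (Eventually.of_forall fun _ => zero_le) ?_
  filter_upwards [hm.eventually_gt_atTop 0] with n hn
  exact key lam hl0 hl1 n hn

lemma exp_sq_lip (a b : ℝ) :
    |Real.exp (-(a ^ 2) / 2) - Real.exp (-(b ^ 2) / 2)| ≤ |a - b| := by
  have hd : ∀ x : ℝ, HasDerivAt (fun y : ℝ => Real.exp (-(y ^ 2) / 2))
      (Real.exp (-(x ^ 2) / 2) * (-x)) x := by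
    intro x
    have h1 : HasDerivAt (fun y : ℝ => -(y ^ 2) / 2) (-x) x := by
      have := ((hasDerivAt_pow 2 x).neg).div_const 2
      have e : -x = -(((2 : ℕ) : ℝ) * x ^ (2 - 1)) / 2 := by norm_num; ring
      rw [e]
      exact this
    exact h1.exp
  have hb : ∀ x : ℝ, ‖Real.exp (-(x ^ 2) / 2) * (-x)‖ ≤ 1 := by
    intro x
    rw [norm_mul, Real.norm_eq_abs, Real.abs_exp, norm_neg, Real.norm_eq_abs]
    have e : -(x ^ 2) / 2 = -(x ^ 2 / 2) := by ring
    rw [e, Real.exp_neg, inv_mul_le_iff₀ (Real.exp_pos _), mul_one]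
    have := Real.add_one_le_exp (x ^ 2 / 2)
    nlinarith [sq_abs x, sq_nonneg (|x| - 1)]
  have := Convex.norm_image_sub_le_of_norm_hasDerivWithin_le (s := Set.univ)
    (f := fun y : ℝ => Real.exp (-(y ^ 2) / 2)) (C := 1)
    (fun x _ => (hd x).hasDerivWithinAt) (fun x _ => hb x) convex_univ
    (Set.mem_univ b) (Set.mem_univ a)
  simpa using this

/-- rescaled Gaussian kernel -/
noncomputable def kf (h t s : ℝ) : ℝ :=
  (1 / h) * (Real.exp (-(((t - s) / h) ^ 2) / 2) / Real.sqrt (2 * Real.pi))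

lemma one_le_sqrt_two_pi : 1 ≤ Real.sqrt (2 * Real.pi) := by
  rw [Real.one_le_sqrt]
  linarith [Real.pi_gt_three]

lemma kf_nonneg {h : ℝ} (hh : 0 < h) (t s : ℝ) : 0 ≤ kf h t s := by
  unfold kf; positivity

lemma kf_le {h : ℝ} (hh : 0 < h) (t s : ℝ) : kf h t s ≤ 1 / h := by
  unfold kf
  refine mul_le_of_le_one_right (by positivity) ?_
  rw [div_le_one (by positivity)]
  refine le_trans ?_ one_le_sqrt_two_pi
  rw [Real.exp_le_one_iff]
  have := sq_nonneg ((t - s) / h)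
  linarith

lemma kf_lip {h : ℝ} (hh : 0 < h) (t t' s : ℝ) : |kf h t s - kf h t' s| ≤ |t - t'| / h ^ 2 := by
  unfold kf
  rw [← mul_sub, ← sub_div, abs_mul, abs_of_pos (by positivity : 0 < 1 / h), abs_div,
    abs_of_pos (by positivity : 0 < Real.sqrt (2 * Real.pi))]
  have h1 := exp_sq_lip ((t - s) / h) ((t' - s) / h)
  have e : (t - s) / h - (t' - s) / h = (t - t') / h := by ring
  rw [e, abs_div, abs_of_pos hh] at h1
  calc _ ≤ 1 / h * (|t - t'| / h) := by
        refine mul_le_mul_of_nonneg_left ?_ (by positivity)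
        refine le_trans ?_ h1
        exact div_le_self (abs_nonneg _) one_le_sqrt_two_pi
    _ = _ := by field_simp

lemma kf_eq {h : ℝ} (hh : 0 < h) (t s : ℝ) :
    kf h t s = ProbabilityTheory.gaussianPDFReal t (h ^ 2).toNNReal s := by
  unfold kf ProbabilityTheory.gaussianPDFReal
  rw [Real.coe_toNNReal _ (sq_nonneg h)]
  rw [Real.sqrt_mul (by positivity : (0 : ℝ) ≤ 2 * Real.pi) (h ^ 2), Real.sqrt_sq hh.le]
  have : -(((t - s) / h) ^ 2) / 2 = -(s - t) ^ 2 / (2 * h ^ 2) := by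
    field_simp
    ring
  rw [this]
  field_simp

lemma kf_meas (h t : ℝ) : Measurable (kf h t) := by
  unfold kf; fun_prop

lemma kf_mean {h : ℝ} (hh : 0 < h) (t : ℝ) (g : ℝ → ℝ) (hg : Measurable g)
    (μ : Measure ℝ) (hμ : μ = volume.withDensity fun t => ENNReal.ofReal (g t)) :
    ∫ s, kf h t s ∂μ
      = ∫ s, max (g s) 0 ∂(ProbabilityTheory.gaussianReal t (h ^ 2).toNNReal) := by
  have hv : (h ^ 2).toNNReal ≠ 0 := by
    have : 0 < h ^ 2 := by positivity
    simpa using hh.ne'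
  rw [ProbabilityTheory.integral_gaussianReal_eq_integral_smul hv, hμ,
    integral_withDensity_eq_integral_toReal_smul (by fun_prop) (ae_of_all _ fun s => by simp)]
  congr 1
  ext s
  rw [kf_eq hh]
  simp [ENNReal.toReal_ofReal', mul_comm]

lemma gauss_second {h : ℝ} (t : ℝ) :
    Integrable (fun s : ℝ => (s - t) ^ 2)
      (ProbabilityTheory.gaussianReal t (h ^ 2).toNNReal) ∧
    ∫ s, (s - t) ^ 2 ∂(ProbabilityTheory.gaussianReal t (h ^ 2).toNNReal) = h ^ 2 := by
  have hm := ProbabilityTheory.memLp_id_gaussianReal (μ := t) (v := (h ^ 2).toNNReal) 2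
  constructor
  · exact (hm.sub (memLp_const t)).integrable_sq
  · have := ProbabilityTheory.variance_fun_id_gaussianReal (μ := t) (v := (h ^ 2).toNNReal)
    rw [ProbabilityTheory.variance_eq_integral (by fun_prop)] at this
    rw [ProbabilityTheory.integral_id_gaussianReal, Real.coe_toNNReal _ (sq_nonneg h)] at this
    exact this

lemma kf_bias {h : ℝ} (hh : 0 < h) (t : ℝ) (g : ℝ → ℝ) (hg : Measurable g)
    (Gb : ℝ) (hGb : ∀ s, max (g s) 0 ≤ Gb) (γ BH : ℝ) (hγ : γ ∈ Set.Ioc (0 : ℝ) 1) (hBH : 0 ≤ BH)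
    (hH : ∀ z z' : ℝ, |g z - g z'| ≤ BH * |z - z'| ^ γ) :
    |∫ s, max (g s) 0 ∂(ProbabilityTheory.gaussianReal t (h ^ 2).toNNReal) - max (g t) 0|
      ≤ 2 * BH * h ^ γ := by
  set ν := ProbabilityTheory.gaussianReal t (h ^ 2).toNNReal with hν
  obtain ⟨i2, e2⟩ := gauss_second (h := h) t
  rw [← hν] at i2 e2
  have hint : Integrable (fun s => max (g s) 0) ν := by
    refine Integrable.of_bound (C := Gb) (by fun_prop) (ae_of_all _ fun s => ?_)
    rw [Real.norm_eq_abs, abs_of_nonneg (le_max_right _ _)]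
    exact hGb s
  have e : ∫ s, max (g s) 0 ∂ν - max (g t) 0 = ∫ s, (max (g s) 0 - max (g t) 0) ∂ν := by
    rw [integral_sub hint (integrable_const _)]; simp
  rw [e]
  have hpt : ∀ s, ‖max (g s) 0 - max (g t) 0‖ ≤ BH * h ^ γ * (1 + (s - t) ^ 2 / h ^ 2) := by
    intro s
    rw [Real.norm_eq_abs]
    refine (abs_max_sub_max_le_abs _ _ _).trans ((hH s t).trans ?_)
    rw [mul_assoc]
    refine mul_le_mul_of_nonneg_left ?_ hBH
    set u := |s - t| / h with hu
    have hu0 : 0 ≤ u := by positivity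
    have e1 : |s - t| = h * u := by rw [hu]; field_simp
    have e2 : (s - t) ^ 2 / h ^ 2 = u ^ 2 := by rw [hu, div_pow, sq_abs]
    rw [e1, e2, Real.mul_rpow hh.le hu0]
    refine mul_le_mul_of_nonneg_left ?_ (by positivity)
    rcases le_total u 1 with h1 | h1
    · have := Real.rpow_le_one hu0 h1 hγ.1.le
      nlinarith [sq_nonneg u]
    · have := Real.rpow_le_rpow_of_exponent_le h1 hγ.2
      rw [Real.rpow_one] at this
      nlinarith
  have hbi : Integrable (fun s => BH * h ^ γ * (1 + (s - t) ^ 2 / h ^ 2)) ν :=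
    ((integrable_const 1).add (i2.div_const _)).const_mul _
  have := norm_integral_le_of_norm_le hbi (ae_of_all _ hpt)
  rw [Real.norm_eq_abs] at this
  refine this.trans (le_of_eq ?_)
  rw [integral_const_mul, integral_add (integrable_const 1) (i2.div_const _), integral_div, e2]
  simp
  field_simp
  ring

lemma grid_point {M d t : ℝ} (hd : 0 < d) (ht : |t| ≤ M) :
    ∃ j : ℕ, j < ⌈2 * M / d⌉₊ + 1 ∧ |t - (-M + j * d)| ≤ d := by
  have h1 := abs_le.1 ht
  have h0 : 0 ≤ (t + M) / d := div_nonneg (by linarith) hd.le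
  refine ⟨⌊(t + M) / d⌋₊, ?_, ?_⟩
  · have : (⌊(t + M) / d⌋₊ : ℝ) ≤ ⌈2 * M / d⌉₊ := by
      refine (Nat.floor_le h0).trans (le_trans ?_ (Nat.le_ceil _))
      gcongr
      linarith
    have : ⌊(t + M) / d⌋₊ ≤ ⌈2 * M / d⌉₊ := by exact_mod_cast this
    omega
  · have a1 := Nat.floor_le h0
    have a2 := (Nat.lt_floor_add_one ((t + M) / d)).le
    rw [le_div_iff₀ hd] at a1
    rw [div_le_iff₀ hd] at a2
    rw [abs_le]
    constructor <;> nlinarith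

lemma kde {X : Type*} [MeasurableSpace X] {Ω : Type*} [MeasurableSpace Ω] (P : Measure Ω)
    (μ : Measure X) [IsProbabilityMeasure μ] (m : ℕ → ℕ) (a0 : ℝ) (ha0 : 0 < a0)
    (hm : ∀ᶠ n : ℕ in atTop, a0 * (n : ℝ) ≤ m n)
    (x : ℕ → ℕ → Ω → X) (hx : ∀ n i, Measurable (x n i))
    (hmap : ∀ n, Measure.map (fun ω => fun i : Fin (m n) => x n i ω) P
      = Measure.pi fun _ : Fin (m n) => μ)
    (Y : X → ℝ) (hY : Measurable Y) (g : ℝ → ℝ) (hg : Measurable g)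
    (hlaw : Measure.map Y μ = volume.withDensity fun t => ENNReal.ofReal (g t))
    (Gbd : ℝ) (hGbd : ∀ t, g t ≤ Gbd)
    (γ BH : ℝ) (hγ : γ ∈ Set.Ioc (0 : ℝ) 1)
    (hH : ∀ z z' : ℝ, |g z - g z'| ≤ BH * |z - z'| ^ γ)
    (h : ℕ → ℝ) (hhpos : ∀ n, 0 < h n)
    (hh0 : Tendsto h atTop (nhds 0))
    (hh1 : Tendsto (fun n : ℕ => Real.log n / (n * h n)) atTop (nhds 0))
    (M δ : ℝ) (hM : 0 < M) (hδ : 0 < δ) :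
    HP P (fun n => {ω | ∀ t, |t| ≤ M →
      |(1 / (m n : ℝ)) * ∑ i : Fin (m n), kf (h n) t (Y (x n i ω)) - max (g t) 0| ≤ δ}) := by
  have hBH : 0 ≤ BH := by
    have := (abs_nonneg _).trans (hH 0 1)
    simpa using this
  set Gb : ℝ := max Gbd 0 + 1 with hGbdef
  have hGbpos : 0 < Gb := by positivity
  have hGb : ∀ s, max (g s) 0 ≤ Gb := by
    intro s
    have : max (g s) 0 ≤ max Gbd 0 := max_le_max (hGbd s) le_rfl
    linarith
  have hYlaw : ∀ n t, ∫ y, kf (h n) t (Y y) ∂μ = ∫ s, max (g s) 0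
      ∂(ProbabilityTheory.gaussianReal t (h n ^ 2).toNNReal) := by
    intro n t
    rw [← kf_mean (hhpos n) t g hg _ hlaw, integral_map hY.aemeasurable]
    exact (kf_meas _ _).aestronglyMeasurable
  have hmean : ∀ n t, ∫ y, kf (h n) t (Y y) ∂μ ≤ Gb := by
    intro n t
    rw [hYlaw]
    have : ∫ s, max (g s) 0 ∂(ProbabilityTheory.gaussianReal t (h n ^ 2).toNNReal)
        ≤ ∫ s, Gb ∂(ProbabilityTheory.gaussianReal t (h n ^ 2).toNNReal) := by
      refine integral_mono_of_nonneg (ae_of_all _ fun s => le_max_right _ _)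
        (integrable_const _) (ae_of_all _ hGb)
    simpa using this
  set a : ℝ := δ / 4 with ha
  have hapos : 0 < a := by positivity
  set s : ℝ := min (1 / 2) (a / (2 * Gb)) with hs
  have hspos : 0 < s := by positivity
  have hs1 : s ≤ 1 / 2 := min_le_left _ _
  have hs2 : s * Gb ≤ a / 2 := by
    have := min_le_right (1 / 2) (a / (2 * Gb))
    calc s * Gb ≤ a / (2 * Gb) * Gb := mul_le_mul_of_nonneg_right this hGbpos.le
      _ = a / 2 := by field_simp
  set κ : ℝ := s * a / 2 with hκ
  have hκpos : 0 < κ := by positivity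
  -- pointwise concentration
  have hconc : ∀ n t, 0 < m n →
      P {ω | a < |(1 / (m n : ℝ)) * ∑ i : Fin (m n), kf (h n) t (Y (x n i ω))
        - ∫ y, kf (h n) t (Y y) ∂μ|} ≤ ENNReal.ofReal (2 * Real.exp (-(m n * (h n * κ)))) := by
    intro n t hmn
    have hhn := hhpos n
    have hmeasφ : Measurable fun y => kf (h n) t (Y y) := (kf_meas _ _).comp hY
    have hkb : ∀ y, |kf (h n) t (Y y)| ≤ 1 / h n := fun y => by
      rw [abs_of_nonneg (kf_nonneg hhn _ _)]; exact kf_le hhn _ _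
    have hint : Integrable (fun y => kf (h n) t (Y y)) μ :=
      Integrable.of_bound hmeasφ.aestronglyMeasurable (1 / h n) (ae_of_all _ hkb)
    have hV : ∫ y, kf (h n) t (Y y) ^ 2 ∂μ ≤ 1 / h n * Gb := by
      calc ∫ y, kf (h n) t (Y y) ^ 2 ∂μ ≤ ∫ y, 1 / h n * kf (h n) t (Y y) ∂μ := by
            refine integral_mono_of_nonneg (ae_of_all _ fun y => sq_nonneg _)
              (hint.const_mul _) (ae_of_all _ fun y => ?_)
            dsimp only
            rw [sq]
            exact mul_le_mul_of_nonneg_right (kf_le hhn _ _) (kf_nonneg hhn _ _)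
        _ ≤ _ := by
            rw [integral_const_mul]
            exact mul_le_mul_of_nonneg_left (hmean n t) (by positivity)
    refine (conc P μ (m n) hmn (x n) (hx n) (hmap n) _ hmeasφ (s * h n) (1 / h n) (1 / h n * Gb) a
      (by positivity) hkb (by field_simp; linarith) hV).trans ?_
    apply ENNReal.ofReal_le_ofReal
    refine mul_le_mul_of_nonneg_left (Real.exp_le_exp.2 ?_) (by norm_num)
    rw [neg_le_neg_iff]
    refine mul_le_mul_of_nonneg_left ?_ (by positivity)
    have e : s * h n * a - (s * h n) ^ 2 * (1 / h n * Gb) = h n * (s * (a - s * Gb)) := by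
      field_simp
    rw [e]
    refine mul_le_mul_of_nonneg_left ?_ hhn.le
    rw [hκ]
    nlinarith
  -- rates
  have hrate : ∀ᶠ n : ℕ in atTop, Real.log n ≤ (a0 * κ / 3) * (n * h n) := by
    have hpos : 0 < a0 * κ / 3 := by positivity
    filter_upwards [hh1.eventually (gt_mem_nhds hpos), eventually_gt_atTop 0] with n hn hn0
    have : (0 : ℝ) < n := by exact_mod_cast hn0
    have h2 : 0 < (n : ℝ) * h n := mul_pos this (hhpos n)
    rw [div_lt_iff₀ h2] at hn
    exact hn.le
  have hnh : ∀ᶠ n : ℕ in atTop, 1 ≤ n * h n := by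
    filter_upwards [hh1.eventually (gt_mem_nhds one_pos), eventually_ge_atTop 3] with n hn hn3
    have h3 : (3 : ℝ) ≤ n := by exact_mod_cast hn3
    have h2 : 0 < (n : ℝ) * h n := mul_pos (by linarith) (hhpos n)
    rw [div_lt_iff₀ h2, one_mul] at hn
    have : 1 ≤ Real.log n := by
      rw [Real.le_log_iff_exp_le (by linarith)]
      linarith [Real.exp_one_lt_d9]
    linarith
  have hpow0 : Tendsto (fun n => h n ^ γ) atTop (nhds 0) := by
    have := hh0.rpow_const (p := γ) (Or.inr hγ.1.le)
    rwa [Real.zero_rpow hγ.1.ne'] at this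
  have hbias : ∀ᶠ n in atTop, 2 * BH * h n ^ γ < δ / 4 := by
    have := hpow0.const_mul (2 * BH)
    rw [mul_zero] at this
    exact this.eventually (gt_mem_nhds hapos)
  have hosc : ∀ᶠ n in atTop, BH * (a * h n ^ 2) ^ γ < δ / 4 := by
    have h1 : Tendsto (fun n => a * h n ^ 2) atTop (nhds 0) := by
      simpa using (hh0.pow 2).const_mul a
    have h2 := h1.rpow_const (p := γ) (Or.inr hγ.1.le)
    rw [Real.zero_rpow hγ.1.ne'] at h2
    have := h2.const_mul BH
    rw [mul_zero] at this
    exact this.eventually (gt_mem_nhds hapos)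
  set J : ℕ → ℕ := fun n => ⌈2 * M / (a * h n ^ 2)⌉₊ + 1 with hJ
  set A : ℕ → Set Ω := fun n => {ω | ∀ j < J n,
    |(1 / (m n : ℝ)) * ∑ i : Fin (m n), kf (h n) (-M + j * (a * h n ^ 2)) (Y (x n i ω))
        - ∫ y, kf (h n) (-M + j * (a * h n ^ 2)) (Y y) ∂μ| ≤ a} with hAdef
  have hA : HP P A := by
    unfold HP
    have hlim : Tendsto (fun n : ℕ => ENNReal.ofReal (2 * (2 * M / a + 2) / n)) atTop (nhds 0) := by
      rw [← ENNReal.ofReal_zero]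
      apply ENNReal.tendsto_ofReal
      exact tendsto_const_div_atTop_nhds_zero_nat _
    refine tendsto_of_tendsto_of_tendsto_of_le_of_le' tendsto_const_nhds hlim
      (Eventually.of_forall fun _ => zero_le) ?_
    filter_upwards [hrate, hnh, hm, eventually_gt_atTop 0] with n h1 h2 h3 h4
    have hn0 : (0 : ℝ) < n := by exact_mod_cast h4
    have hn1 : (1 : ℝ) ≤ n := by exact_mod_cast h4
    have hmn : 0 < m n := by
      have : (0 : ℝ) < m n := lt_of_lt_of_le (by positivity) h3
      exact_mod_cast this
    have hhn := hhpos n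
    have hsub : (A n)ᶜ ⊆ ⋃ j ∈ Finset.range (J n), {ω | a <
        |(1 / (m n : ℝ)) * ∑ i : Fin (m n), kf (h n) (-M + j * (a * h n ^ 2)) (Y (x n i ω))
        - ∫ y, kf (h n) (-M + j * (a * h n ^ 2)) (Y y) ∂μ|} := by
      intro ω hω
      simp only [hAdef, Set.mem_compl_iff, Set.mem_ofPred_eq, not_forall, not_le] at hω
      obtain ⟨j, hj, hj2⟩ := hω
      simp only [Set.mem_iUnion]
      exact ⟨j, Finset.mem_range.2 hj, hj2⟩
    refine (measure_mono hsub).trans ((measure_biUnion_finset_le _ _).trans ?_)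
    refine (Finset.sum_le_sum fun j _ => hconc n _ hmn).trans ?_
    rw [Finset.sum_const, Finset.card_range, nsmul_eq_mul, ← ENNReal.ofReal_natCast,
      ← ENNReal.ofReal_mul (by positivity)]
    apply ENNReal.ofReal_le_ofReal
    have hexp : Real.exp (-(m n * (h n * κ))) ≤ 1 / (n : ℝ) ^ 3 := by
      have : Real.exp (-(m n * (h n * κ))) ≤ Real.exp (-(3 * Real.log n)) := by
        rw [Real.exp_le_exp, neg_le_neg_iff]
        have := mul_le_mul_of_nonneg_right h3 (by positivity : 0 ≤ h n * κ)
        nlinarith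
      refine this.trans (le_of_eq ?_)
      rw [Real.exp_neg, ← Real.log_rpow hn0, Real.exp_log (by positivity)]
      norm_num
    have hJn : (J n : ℝ) ≤ (2 * M / a + 2) * n ^ 2 := by
      have c1 : (J n : ℝ) ≤ 2 * M / (a * h n ^ 2) + 2 := by
        simp only [hJ]; push_cast
        have := (Nat.ceil_lt_add_one (by positivity : 0 ≤ 2 * M / (a * h n ^ 2))).le
        linarith
      have c2 : 2 * M / (a * h n ^ 2) ≤ 2 * M / a * n ^ 2 := by
        rw [div_le_iff₀ (by positivity)]
        have : 2 * M / a * n ^ 2 * (a * h n ^ 2) = 2 * M * (n * h n) ^ 2 := by field_simp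
        rw [this]
        have : 1 ≤ ((n : ℝ) * h n) ^ 2 := one_le_pow₀ h2
        nlinarith
      have c3 : (1 : ℝ) ≤ (n : ℝ) ^ 2 := one_le_pow₀ hn1
      nlinarith
    calc (J n : ℝ) * (2 * Real.exp (-(m n * (h n * κ))))
        ≤ (2 * M / a + 2) * n ^ 2 * (2 * (1 / (n : ℝ) ^ 3)) := by
          refine mul_le_mul hJn (by linarith) (by positivity) (by positivity)
      _ = _ := by field_simp
  refine hA.mono ?_
  filter_upwards [hbias, hosc, hm, eventually_gt_atTop 0] with n hb1 ho1 hm1 hn0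
  intro ω hω t ht
  have hhn := hhpos n
  have hmn : (0 : ℝ) < m n :=
    lt_of_lt_of_le (mul_pos ha0 (by exact_mod_cast hn0)) hm1
  obtain ⟨j, hj, hjt⟩ := grid_point (d := a * h n ^ 2) (by positivity) ht
  have q1 := hω j hj
  set tj := -M + j * (a * h n ^ 2) with htj
  have q2 : |∫ y, kf (h n) tj (Y y) ∂μ - max (g tj) 0| ≤ δ / 4 := by
    rw [hYlaw]
    exact (kf_bias hhn tj g hg Gb hGb γ BH hγ hBH hH).trans hb1.le
  have q3 : |max (g tj) 0 - max (g t) 0| ≤ δ / 4 := by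
    refine (abs_max_sub_max_le_abs _ _ _).trans ((hH _ _).trans (le_trans ?_ ho1.le))
    rw [abs_sub_comm]
    exact mul_le_mul_of_nonneg_left
      (Real.rpow_le_rpow (abs_nonneg _) hjt hγ.1.le) hBH
  have q4 : |(1 / (m n : ℝ)) * ∑ i : Fin (m n), kf (h n) t (Y (x n i ω))
      - (1 / (m n : ℝ)) * ∑ i : Fin (m n), kf (h n) tj (Y (x n i ω))| ≤ δ / 4 := by
    rw [← mul_sub, ← Finset.sum_sub_distrib, abs_mul, abs_of_pos (by positivity)]
    have : |∑ i : Fin (m n), (kf (h n) t (Y (x n i ω)) - kf (h n) tj (Y (x n i ω)))|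
        ≤ m n * a := by
      refine (Finset.abs_sum_le_sum_abs _ _).trans ?_
      have : ∀ i ∈ (Finset.univ : Finset (Fin (m n))),
          |kf (h n) t (Y (x n i ω)) - kf (h n) tj (Y (x n i ω))| ≤ a := by
        intro i _
        refine (kf_lip hhn _ _ _).trans ?_
        rw [div_le_iff₀ (by positivity)]
        exact hjt
      refine (Finset.sum_le_sum this).trans ?_
      simp
    calc _ ≤ 1 / (m n : ℝ) * (m n * a) := mul_le_mul_of_nonneg_left this (by positivity)
      _ = δ / 4 := by field_simp; linarith
  rw [ha] at q1
  rw [abs_le] at *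
  constructor <;> linarith [q1.1, q1.2, q2.1, q2.2, q3.1, q3.2, q4.1, q4.2]

lemma quant {X : Type*} (m : ℕ) (x : ℕ → X) (u v : X → ℝ) (E : Set X) (Q δ ζ : ℝ)
    (hE : ∀ y, y ∉ E → |u y - v y| ≤ δ)
    (h1 : ζ + emp m x E < emp m x {y | v y ≤ Q + δ})
    (h2 : emp m x {y | v y ≤ Q - δ} + emp m x E ≤ ζ) :
    Q - 2 * δ ≤ sSup {t : ℝ | emp m x {y | u y ≤ t} ≤ ζ} ∧
      sSup {t : ℝ | emp m x {y | u y ≤ t} ≤ ζ} ≤ Q + 2 * δ := by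
  have hmem : Q - 2 * δ ∈ {t : ℝ | emp m x {y | u y ≤ t} ≤ ζ} := by
    refine (emp_le_add m x ?_).trans h2
    intro y hy
    by_cases hyE : y ∈ E
    · exact Or.inr hyE
    · left
      have := abs_le.1 (hE y hyE)
      have hy' : u y ≤ Q - 2 * δ := hy
      show v y ≤ Q - δ
      linarith [this.1]
  have hub : ∀ t ∈ {t : ℝ | emp m x {y | u y ≤ t} ≤ ζ}, t ≤ Q + 2 * δ := by
    intro t ht
    by_contra hlt
    push Not at hlt
    have h3 : emp m x {y | v y ≤ Q + δ} ≤ emp m x {y | u y ≤ t} + emp m x E := by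
      refine emp_le_add m x ?_
      intro y hy
      by_cases hyE : y ∈ E
      · exact Or.inr hyE
      · left
        have := abs_le.1 (hE y hyE)
        have hy' : v y ≤ Q + δ := hy
        show u y ≤ t
        linarith [this.2]
    have ht' : emp m x {y | u y ≤ t} ≤ ζ := ht
    linarith
  exact ⟨le_csSup ⟨_, hub⟩ hmem, csSup_le ⟨_, hmem⟩ hub⟩

lemma level {X : Type*} (m : ℕ) (x : ℕ → X) (u v : X → ℝ) (E : Set X) (Q Qh δ : ℝ)
    (hE : ∀ y, y ∉ E → |u y - v y| ≤ δ)
    (h1 : Q - 2 * δ ≤ Qh) (h2 : Qh ≤ Q + 2 * δ) :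
    |emp m x {y | Qh ≤ u y} - emp m x {y | Q ≤ v y}|
      ≤ emp m x E + emp m x {y | |v y - Q| ≤ 3 * δ} := by
  have hED := emp_le_add m x (Set.Subset.refl (E ∪ {y | |v y - Q| ≤ 3 * δ}))
  have a1 : emp m x {y | Qh ≤ u y} ≤ emp m x {y | Q ≤ v y} +
      emp m x (E ∪ {y | |v y - Q| ≤ 3 * δ}) := by
    refine emp_le_add m x ?_
    intro y hy
    have hy' : Qh ≤ u y := hy
    by_cases hyE : y ∈ E
    · exact Or.inr (Or.inl hyE)
    by_cases hyQ : Q ≤ v y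
    · exact Or.inl hyQ
    · refine Or.inr (Or.inr ?_)
      have := abs_le.1 (hE y hyE)
      show |v y - Q| ≤ 3 * δ
      rw [abs_le]
      constructor <;> linarith [this.1, this.2]
  have a2 : emp m x {y | Q ≤ v y} ≤ emp m x {y | Qh ≤ u y} +
      emp m x (E ∪ {y | |v y - Q| ≤ 3 * δ}) := by
    refine emp_le_add m x ?_
    intro y hy
    have hy' : Q ≤ v y := hy
    by_cases hyE : y ∈ E
    · exact Or.inr (Or.inl hyE)
    by_cases hyQ : Qh ≤ u y
    · exact Or.inl hyQ
    · refine Or.inr (Or.inr ?_)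
      have := abs_le.1 (hE y hyE)
      show |v y - Q| ≤ 3 * δ
      rw [abs_le]
      constructor <;> linarith [this.1, this.2]
  rw [abs_le]
  constructor <;> linarith

lemma femp {X : Type*} [MeasurableSpace X] [MeasurableSingletonClass X] (m : ℕ) (x : ℕ → X)
    (B : Set X) :
    ((((m : ℝ≥0∞))⁻¹ • ∑ i : Fin m, Measure.dirac (x i)) B).toReal = emp m x B := by
  rw [Measure.smul_apply, Measure.finsetSum_apply, smul_eq_mul, ENNReal.toReal_mul,
    ENNReal.toReal_sum (fun i _ => measure_ne_top _ _)]
  unfold emp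
  simp only [ENNReal.toReal_inv, ENNReal.toReal_natCast, one_div]
  congr 1
  refine Finset.sum_congr rfl fun i _ => ?_
  rw [Measure.dirac_apply, Set.indicator_apply]
  split_ifs <;> simp

lemma tight {X : Type*} [MeasurableSpace X] (μ : Measure X) [IsProbabilityMeasure μ]
    (Y : X → ℝ) (hY : Measurable Y) (ρ : ℝ) (hρ : 0 < ρ) :
    ∃ M0 : ℝ, ∀ M, M0 ≤ M → (μ {y | M < |Y y|}).toReal ≤ ρ := by
  have h := tendsto_measure_iInter_atTop (μ := μ) (s := fun n : ℕ => {y | (n : ℝ) < |Y y|})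
    (fun n => (measurableSet_lt measurable_const hY.abs).nullMeasurableSet)
    (by
      intro a b hab y hy
      have : (b : ℝ) < |Y y| := hy
      have hab' : (a : ℝ) ≤ b := by exact_mod_cast hab
      exact lt_of_le_of_lt hab' this) ⟨0, measure_ne_top _ _⟩
  have he : (⋂ n : ℕ, {y | (n : ℝ) < |Y y|}) = ∅ := by
    ext y
    simp only [Set.mem_iInter, Set.mem_ofPred_eq, Set.mem_empty_iff_false, iff_false, not_forall,
      not_lt]
    exact exists_nat_ge _
  rw [he, measure_empty] at h
  have h2 := (ENNReal.tendsto_toReal ENNReal.zero_ne_top).comp h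
  rw [ENNReal.toReal_zero] at h2
  obtain ⟨n, hn⟩ := (h2.eventually (gt_mem_nhds hρ)).exists
  refine ⟨n, fun M hM => le_trans ?_ (le_of_lt hn)⟩
  refine ENNReal.toReal_mono (measure_ne_top _ _) (measure_mono fun y hy => ?_)
  exact lt_of_le_of_lt hM hy

lemma shrink {X : Type*} [MeasurableSpace X] (μ : Measure X) [IsProbabilityMeasure μ]
    (v : X → ℝ) (hv : Measurable v) (Q : ℝ) (h0 : μ {y | v y = Q} = 0) (ρ : ℝ) (hρ : 0 < ρ) :
    ∀ᶠ δ in nhdsWithin (0 : ℝ) (Set.Ioi 0), (μ {y | |v y - Q| ≤ 3 * δ}).toReal ≤ ρ := by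
  have : IsProbabilityMeasure (μ.map v) := Measure.isProbabilityMeasure_map hv.aemeasurable
  have h := tendsto_measure_Icc_nhdsWithin_right' (μ.map v) Q
  have e0 : (μ.map v) {Q} = 0 := by
    rw [Measure.map_apply hv (measurableSet_singleton Q)]; exact h0
  rw [e0] at h
  have h2 := (ENNReal.tendsto_toReal ENNReal.zero_ne_top).comp h
  rw [ENNReal.toReal_zero] at h2
  have h3 : Tendsto (fun δ : ℝ => 3 * δ) (nhdsWithin (0 : ℝ) (Set.Ioi 0))
      (nhdsWithin (0 : ℝ) (Set.Ioi 0)) := by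
    refine tendsto_nhdsWithin_of_tendsto_nhds_of_eventually_within _ ?_ ?_
    · have : Tendsto (fun δ : ℝ => 3 * δ) (nhds 0) (nhds (3 * 0)) := by
        exact (continuous_const.mul continuous_id).tendsto 0
      rw [mul_zero] at this
      exact this.mono_left nhdsWithin_le_nhds
    · filter_upwards [self_mem_nhdsWithin] with δ hδ
      have : (0 : ℝ) < δ := hδ
      show (0 : ℝ) < 3 * δ
      linarith
  filter_upwards [(h2.comp h3).eventually (gt_mem_nhds hρ)] with δ hδ
  refine le_trans (le_of_eq ?_) (le_of_lt hδ)
  simp only [Function.comp]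
  rw [Measure.map_apply hv measurableSet_Icc]
  congr 2
  ext y
  simp only [Set.mem_preimage, Set.mem_Icc, Set.mem_ofPred_eq, abs_le]
  constructor <;> rintro ⟨a, b⟩ <;> constructor <;> linarith

lemma pair {X : Type*} [MeasurableSpace X] {Ω : Type*} [MeasurableSpace Ω] (P : Measure Ω)
    (μ : Measure X) [IsProbabilityMeasure μ] (m : ℕ → ℕ) (a0 : ℝ) (ha0 : 0 < a0)
    (hm : ∀ᶠ n : ℕ in atTop, a0 * (n : ℝ) ≤ m n) (hmt : Tendsto m atTop atTop)
    (x : ℕ → ℕ → Ω → X) (hx : ∀ n i, Measurable (x n i))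
    (hmap : ∀ n, Measure.map (fun ω => fun i : Fin (m n) => x n i ω) P
      = Measure.pi fun _ : Fin (m n) => μ)
    (ν : Measure X) [IsProbabilityMeasure ν] (m' : ℕ → ℕ) (hmt' : Tendsto m' atTop atTop)
    (x' : ℕ → ℕ → Ω → X) (hx' : ∀ n i, Measurable (x' n i))
    (hmap' : ∀ n, Measure.map (fun ω => fun i : Fin (m' n) => x' n i ω) P
      = Measure.pi fun _ : Fin (m' n) => ν)
    (Y : X → ℝ) (hY : Measurable Y) (g : ℝ → ℝ) (hg : Measurable g)
    (hlaw : Measure.map Y μ = volume.withDensity fun t => ENNReal.ofReal (g t))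
    (Gbd : ℝ) (hGbd : ∀ t, g t ≤ Gbd)
    (γ BH : ℝ) (hγ : γ ∈ Set.Ioc (0 : ℝ) 1)
    (hH : ∀ z z' : ℝ, |g z - g z'| ≤ BH * |z - z'| ^ γ)
    (h : ℕ → ℝ) (hhpos : ∀ n, 0 < h n)
    (hh0 : Tendsto h atTop (nhds 0))
    (hh1 : Tendsto (fun n : ℕ => Real.log n / (n * h n)) atTop (nhds 0))
    (gh : ℕ → Ω → ℝ → ℝ)
    (hgh : ∀ n ω t, gh n ω t = (1 / (m n : ℝ)) * ∑ i : Fin (m n), kf (h n) t (Y (x n i ω)))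
    (Q ζ δ₀ : ℝ) (hQ : 0 < Q) (hδ₀ : 0 < δ₀)
    (hup : ∀ δ, 0 < δ → δ ≤ δ₀ → ζ < (μ {y | g (Y y) ≤ Q + δ}).toReal)
    (hlo : ∀ δ, 0 < δ → δ ≤ δ₀ → (μ {y | g (Y y) ≤ Q - δ}).toReal < ζ)
    (hν : ν {y | g (Y y) = Q} = 0) (τ : ℝ) (hτ : 0 < τ) :
    HP P (fun n => {ω | |emp (m' n) (fun i => x' n i ω)
        {y | sSup {t : ℝ | emp (m n) (fun i => x n i ω) {y | gh n ω (Y y) ≤ t} ≤ ζ} ≤ gh n ω (Y y)}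
        - (ν {y | Q ≤ g (Y y)}).toReal| ≤ τ}) := by
  set v : X → ℝ := fun y => max (g (Y y)) 0 with hv
  have hvm : Measurable v := (hg.comp hY).max measurable_const
  have hvle : ∀ t, 0 ≤ t → {y | v y ≤ t} = {y | g (Y y) ≤ t} := by
    intro t ht
    ext y
    simp [hv, ht]
  have hvge : {y | Q ≤ v y} = {y | Q ≤ g (Y y)} := by
    ext y
    simp [hv, not_le.2 hQ]
  have hveq : {y | v y = Q} = {y | g (Y y) = Q} := by
    ext y
    simp only [hv, Set.mem_ofPred_eq]
    constructor
    · intro h1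
      rcases max_choice (g (Y y)) 0 with h2 | h2
      · rw [← h2, h1]
      · rw [h2] at h1; exact absurd h1 hQ.ne
    · intro h1; rw [h1]; exact max_eq_left hQ.le
  obtain ⟨δ, hδD, hδpos, hδ1⟩ : ∃ δ, (ν {y | |v y - Q| ≤ 3 * δ}).toReal ≤ τ / 6 ∧ 0 < δ ∧
      δ < min δ₀ Q := by
    have hmem : Set.Iio (min δ₀ Q) ∈ nhdsWithin (0 : ℝ) (Set.Ioi 0) :=
      mem_nhdsWithin_of_mem_nhds (Iio_mem_nhds (lt_min hδ₀ hQ))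
    have := ((shrink ν v hvm Q (by rw [hveq]; exact hν) (τ / 6) (by positivity)).and
      (self_mem_nhdsWithin : Set.Ioi (0 : ℝ) ∈ nhdsWithin (0 : ℝ) (Set.Ioi 0))).and hmem
    obtain ⟨δ, ⟨h1, h2⟩, h3⟩ := this.exists
    exact ⟨δ, h1, h2, h3⟩
  have hδδ₀ : δ ≤ δ₀ := (hδ1.trans_le (min_le_left _ _)).le
  have hδQ : δ ≤ Q := (hδ1.trans_le (min_le_right _ _)).le
  have hup' := hup δ hδpos hδδ₀
  have hlo' := hlo δ hδpos hδδ₀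
  rw [← hvle _ (by linarith)] at hup' hlo'
  set U := (μ {y | v y ≤ Q + δ}).toReal with hU
  set L := (μ {y | v y ≤ Q - δ}).toReal with hL
  obtain ⟨ρ, hρ, hρ1, hρ2⟩ : ∃ ρ : ℝ, 0 < ρ ∧ ζ + 4 * ρ ≤ U ∧ L + 4 * ρ ≤ ζ := by
    refine ⟨min (U - ζ) (ζ - L) / 4, ?_, ?_, ?_⟩
    · have : 0 < min (U - ζ) (ζ - L) := lt_min (by linarith) (by linarith)
      positivity
    · linarith [min_le_left (U - ζ) (ζ - L)]
    · linarith [min_le_right (U - ζ) (ζ - L)]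
  obtain ⟨M1, hM1⟩ := tight μ Y hY ρ hρ
  obtain ⟨M2, hM2⟩ := tight ν Y hY (τ / 6) (by positivity)
  set M := max (max M1 M2) 1 with hM
  have hμE := hM1 M (le_trans (le_max_left _ _) (le_max_left _ _))
  have hνE := hM2 M (le_trans (le_max_right _ _) (le_max_left _ _))
  have hMpos : 0 < M := lt_of_lt_of_le one_pos (le_max_right _ _)
  set E : Set X := {y | M < |Y y|} with hE
  have hEm : MeasurableSet E := measurableSet_lt measurable_const hY.abs
  have ev1 := kde P μ m a0 ha0 hm x hx hmap Y hY g hg hlaw Gbd hGbd γ BH hγ hH h hhpos hh0 hh1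
    M δ hMpos hδpos
  have ev2 := lln P μ m hmt x hx hmap E hEm (ρ / 2) (by positivity)
  have ev3 := lln P μ m hmt x hx hmap {y | v y ≤ Q + δ} (measurableSet_le hvm measurable_const)
    (ρ / 2) (by positivity)
  have ev4 := lln P μ m hmt x hx hmap {y | v y ≤ Q - δ} (measurableSet_le hvm measurable_const)
    (ρ / 2) (by positivity)
  have ev5 := lln P ν m' hmt' x' hx' hmap' E hEm (τ / 6) (by positivity)
  have ev6 := lln P ν m' hmt' x' hx' hmap' {y | |v y - Q| ≤ 3 * δ}
    (measurableSet_le (hvm.sub measurable_const).abs measurable_const) (τ / 6) (by positivity)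
  have ev7 := lln P ν m' hmt' x' hx' hmap' {y | Q ≤ v y} (measurableSet_le measurable_const hvm)
    (τ / 6) (by positivity)
  refine ((((((ev1.inter ev2).inter ev3).inter ev4).inter ev5).inter ev6).inter ev7).mono
    (Eventually.of_forall fun n => ?_)
  rintro ω ⟨⟨⟨⟨⟨⟨w1, w2⟩, w3⟩, w4⟩, w5⟩, w6⟩, w7⟩
  simp only [Set.mem_ofPred_eq] at w1 w2 w3 w4 w5 w6 w7 ⊢
  have hEc : ∀ y, y ∉ E → |gh n ω (Y y) - v y| ≤ δ := by
    intro y hy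
    have hy' : |Y y| ≤ M := not_lt.1 hy
    rw [hgh]
    exact w1 _ hy'
  rw [abs_le] at w2 w3 w4 w5 w6 w7
  have hq := quant (m n) (fun i => x n i ω) (fun y => gh n ω (Y y)) v E Q δ ζ hEc
    (by linarith [w2.2, w3.1]) (by linarith [w2.2, w4.2])
  have hlv := level (m' n) (fun i => x' n i ω) (fun y => gh n ω (Y y)) v E Q _ δ hEc hq.1 hq.2
  rw [← hvge]
  rw [abs_le] at hlv ⊢
  constructor <;> linarith [hlv.1, hlv.2, w5.1, w5.2, w6.1, w6.2, w7.1, w7.2]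

lemma sq_sum_le {K : ℕ} (a : Fin K → ℝ) : (∑ k, a k) ^ 2 ≤ K * ∑ k, a k ^ 2 := by
  have := sq_sum_le_card_mul_sum_sq (s := Finset.univ) (f := a)
  simpa using this

lemma ls (K : ℕ) (A B : Fin K → Fin K → ℝ) (b p0 ph : Fin K → ℝ) (c₀ τ : ℝ)
    (hc : ∀ w : Fin K → ℝ, c₀ * (∑ i, w i ^ 2) ≤ ∑ l, (∑ k, A l k * w k) ^ 2)
    (hA : ∀ l k, |B l k - A l k| ≤ τ) (hτ : 0 ≤ τ)
    (hb : ∀ l, |b l - ∑ k, A l k * p0 k| ≤ τ) (hp : ∀ k, |p0 k| ≤ 1)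
    (hmin : ∑ l, (b l - ∑ k, B l k * ph k) ^ 2 ≤ ∑ l, (b l - ∑ k, B l k * p0 k) ^ 2) :
    (c₀ - 2 * K ^ 2 * τ ^ 2) * ∑ i, (ph i - p0 i) ^ 2 ≤ 8 * K * (1 + K) ^ 2 * τ ^ 2 := by
  set w : Fin K → ℝ := fun i => ph i - p0 i with hw
  have h0 := hc w
  -- residual at p0
  have hr : ∑ l, (b l - ∑ k, B l k * p0 k) ^ 2 ≤ K * ((1 + K) * τ) ^ 2 := by
    have : ∀ l ∈ (Finset.univ : Finset (Fin K)),
        (b l - ∑ k, B l k * p0 k) ^ 2 ≤ ((1 + K) * τ) ^ 2 := by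
      intro l _
      apply sq_le_sq'
      all_goals
        have e : b l - ∑ k, B l k * p0 k
            = (b l - ∑ k, A l k * p0 k) - ∑ k, (B l k - A l k) * p0 k := by
          simp only [sub_mul, Finset.sum_sub_distrib]; ring
        have h2 : |∑ k, (B l k - A l k) * p0 k| ≤ K * τ := by
          refine (Finset.abs_sum_le_sum_abs _ _).trans ?_
          have : ∀ k ∈ (Finset.univ : Finset (Fin K)), |(B l k - A l k) * p0 k| ≤ τ := by
            intro k _
            rw [abs_mul]
            calc _ ≤ τ * 1 := mul_le_mul (hA l k) (hp k) (abs_nonneg _) hτ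
              _ = τ := mul_one _
          refine (Finset.sum_le_sum this).trans ?_
          simp
        have h1 := abs_le.1 (hb l)
        have h2' := abs_le.1 h2
        rw [e]
        nlinarith [h1.1, h1.2, h2'.1, h2'.2]
    refine (Finset.sum_le_sum this).trans ?_
    simp
  have hBw : ∑ l, (∑ k, B l k * w k) ^ 2 ≤ 4 * (K * ((1 + K) * τ) ^ 2) := by
    have : ∀ l ∈ (Finset.univ : Finset (Fin K)), (∑ k, B l k * w k) ^ 2 ≤
        2 * (b l - ∑ k, B l k * ph k) ^ 2 + 2 * (b l - ∑ k, B l k * p0 k) ^ 2 := by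
      intro l _
      have e : ∑ k, B l k * w k = (b l - ∑ k, B l k * p0 k) - (b l - ∑ k, B l k * ph k) := by
        simp only [hw, mul_sub, Finset.sum_sub_distrib]; ring
      rw [e]
      nlinarith [sq_nonneg ((b l - ∑ k, B l k * p0 k) + (b l - ∑ k, B l k * ph k))]
    refine (Finset.sum_le_sum this).trans ?_
    rw [Finset.sum_add_distrib, ← Finset.mul_sum, ← Finset.mul_sum]
    linarith
  have hAw : ∑ l, (∑ k, A l k * w k) ^ 2 ≤
      2 * (∑ l, (∑ k, B l k * w k) ^ 2) + 2 * (K * (K * (τ ^ 2 * ∑ i, w i ^ 2))) := by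
    have : ∀ l ∈ (Finset.univ : Finset (Fin K)), (∑ k, A l k * w k) ^ 2 ≤
        2 * (∑ k, B l k * w k) ^ 2 + 2 * (K * (τ ^ 2 * ∑ i, w i ^ 2)) := by
      intro l _
      have e : ∑ k, A l k * w k = (∑ k, B l k * w k) - ∑ k, (B l k - A l k) * w k := by
        simp only [sub_mul, Finset.sum_sub_distrib]; ring
      have h2 : (∑ k, (B l k - A l k) * w k) ^ 2 ≤ K * (τ ^ 2 * ∑ i, w i ^ 2) := by
        refine (sq_sum_le _).trans (mul_le_mul_of_nonneg_left ?_ (by positivity))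
        rw [Finset.mul_sum]
        refine Finset.sum_le_sum fun k _ => ?_
        rw [mul_pow]
        refine mul_le_mul_of_nonneg_right ?_ (sq_nonneg _)
        rw [← sq_abs]
        exact pow_le_pow_left₀ (abs_nonneg _) (hA l k) 2
      rw [e]
      nlinarith [sq_nonneg ((∑ k, B l k * w k) + ∑ k, (B l k - A l k) * w k)]
    refine (Finset.sum_le_sum this).trans ?_
    rw [Finset.sum_add_distrib, ← Finset.mul_sum]
    simp
    ring_nf
    rfl
  nlinarith

lemma ratio_tendsto (m : ℕ → ℕ) (a0 : ℝ) (ha0 : 0 < a0)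
    (hm : ∀ᶠ n : ℕ in atTop, a0 * (n : ℝ) ≤ m n) : Tendsto m atTop atTop := by
  rw [← tendsto_natCast_atTop_iff (R := ℝ)]
  exact tendsto_atTop_mono' _ hm (tendsto_natCast_atTop_atTop.const_mul_atTop ha0)

lemma ratio_ev (m : ℕ → ℕ) (c : ℝ) 
    (hm : ∀ᶠ n : ℕ in atTop, c ≤ (m n : ℝ) / n) :
    ∀ᶠ n : ℕ in atTop, c * (n : ℝ) ≤ m n := by
  filter_upwards [hm, eventually_gt_atTop 0] with n hn hn0
  have : (0 : ℝ) < n := by exact_mod_cast hn0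
  rwa [le_div_iff₀ this] at hn

lemma liminf_ev (u : ℕ → ℝ) (c : ℝ) (hc : 0 < c) (h : c ≤ Filter.liminf u atTop) :
    ∀ᶠ n in atTop, c / 2 ≤ u n := by
  rw [Filter.liminf_eq] at h
  have hne : {a : ℝ | ∀ᶠ n in atTop, a ≤ u n}.Nonempty := by
    by_contra hn
    rw [Set.not_nonempty_iff_eq_empty] at hn
    rw [hn, Real.sSup_empty] at h
    linarith
  obtain ⟨a, ha, hca⟩ := exists_lt_of_lt_csSup hne (by linarith : c / 2 < _)
  filter_upwards [ha] with n hn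
  linarith

/-- consequences of Assumption 4 for one class -/
lemma quantile_facts {X : Type*} [MeasurableSpace X] (μ : Measure X) [IsProbabilityMeasure μ]
    (Y : X → ℝ) (hY : Measurable Y) (g : ℝ → ℝ) (hg : Measurable g)
    (hlaw : Measure.map Y μ = volume.withDensity fun t => ENNReal.ofReal (g t))
    (Q ζ γ c₁ c₂ δ₀ : ℝ) (hζ : 0 < ζ) (hγ : 0 < γ) (hc₁ : 0 < c₁) (hδ₀ : 0 < δ₀)
    (hA4 : ∀ δ : ℝ, |δ| ≤ δ₀ →
      c₁ * |δ| ^ γ ≤ |(μ {x | g (Y x) ≤ Q + δ}).toReal - ζ| ∧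
        |(μ {x | g (Y x) ≤ Q + δ}).toReal - ζ| ≤ c₂ * |δ| ^ γ) :
    0 < Q ∧ (∀ δ, 0 < δ → δ ≤ δ₀ → ζ < (μ {y | g (Y y) ≤ Q + δ}).toReal) ∧
    (∀ δ, 0 < δ → δ ≤ δ₀ → (μ {y | g (Y y) ≤ Q - δ}).toReal < ζ) ∧
    volume {t | g t = Q} = 0 := by
  have hmono : ∀ s t : ℝ, s ≤ t →
      (μ {y | g (Y y) ≤ s}).toReal ≤ (μ {y | g (Y y) ≤ t}).toReal := fun s t hst =>
    ENNReal.toReal_mono (measure_ne_top _ _) (measure_mono fun y hy => le_trans hy hst)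
  have hz : (μ {y | g (Y y) ≤ Q}).toReal = ζ := by
    have := (hA4 0 (by simpa using hδ₀.le)).2
    rw [abs_zero, Real.zero_rpow hγ.ne', mul_zero, add_zero] at this
    exact sub_eq_zero.1 (abs_nonpos_iff.1 this)
  have hgY : Measurable fun y => g (Y y) := hg.comp hY
  have hQ : 0 < Q := by
    by_contra hle
    push Not at hle
    have h0 : μ {y | g (Y y) ≤ 0} = 0 := by
      have e : μ {y | g (Y y) ≤ 0} = Measure.map Y μ {t | g t ≤ 0} := by
        rw [Measure.map_apply hY (measurableSet_le hg measurable_const)]; rfl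
      rw [e, hlaw, withDensity_apply _ (measurableSet_le hg measurable_const)]
      rw [setLIntegral_congr_fun (g := fun _ => 0) (measurableSet_le hg measurable_const)]
      · simp
      · intro t ht
        exact ENNReal.ofReal_of_nonpos ht
    have := hmono Q 0 hle
    rw [hz, h0] at this
    simp at this
    linarith
  have hlow : ∀ δ, 0 < δ → δ ≤ δ₀ → (μ {y | g (Y y) ≤ Q - δ}).toReal < ζ := by
    intro δ hδ hδ1
    have h1 := (hA4 (-δ) (by rwa [abs_neg, abs_of_pos hδ])).1
    rw [abs_neg, abs_of_pos hδ, ← sub_eq_add_neg] at h1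
    have h2 := hmono (Q - δ) Q (by linarith)
    rw [hz] at h2
    have h3 : 0 < c₁ * δ ^ γ := by positivity
    rw [abs_of_nonpos (by linarith)] at h1
    linarith
  refine ⟨hQ, ?_, hlow, ?_⟩
  · intro δ hδ hδ1
    have h1 := (hA4 δ (by rwa [abs_of_pos hδ])).1
    rw [abs_of_pos hδ] at h1
    have h2 := hmono Q (Q + δ) (by linarith)
    rw [hz] at h2
    have h3 : 0 < c₁ * δ ^ γ := by positivity
    rw [abs_of_nonneg (by linarith)] at h1
    linarith
  · have hmQ : MeasurableSet {t | g t = Q} := measurableSet_eq_fun hg measurable_const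
    have h0 : μ {y | g (Y y) = Q} = 0 := by
      have hle : ∀ δ, 0 < δ → δ ≤ δ₀ → (μ {y | g (Y y) = Q}).toReal ≤ c₂ * δ ^ γ := by
        intro δ hδ hδ1
        have h1 := (hA4 (-δ) (by rwa [abs_neg, abs_of_pos hδ])).2
        rw [abs_neg, abs_of_pos hδ, ← sub_eq_add_neg] at h1
        have hdisj : Disjoint {y | g (Y y) ≤ Q - δ} {y | g (Y y) = Q} := by
          rw [Set.disjoint_left]
          intro y hy hy2
          have a1 : g (Y y) ≤ Q - δ := hy
          have a2 : g (Y y) = Q := hy2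
          linarith
        have hu := measure_union (μ := μ) hdisj (measurableSet_eq_fun hgY measurable_const)
        have hs : μ ({y | g (Y y) ≤ Q - δ} ∪ {y | g (Y y) = Q}) ≤ μ {y | g (Y y) ≤ Q} := by
          refine measure_mono ?_
          rintro y (hy | hy)
          · have a1 : g (Y y) ≤ Q - δ := hy
            show g (Y y) ≤ Q
            linarith
          · exact le_of_eq hy
        rw [hu] at hs
        have hs2 := ENNReal.toReal_mono (measure_ne_top _ _) hs
        rw [ENNReal.toReal_add (measure_ne_top _ _) (measure_ne_top _ _), hz] at hs2
        linarith [(abs_le.1 h1).1]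
      have hlim : Tendsto (fun δ : ℝ => c₂ * δ ^ γ) (nhdsWithin 0 (Set.Ioi 0)) (nhds 0) := by
        have h1 : Tendsto (fun δ : ℝ => δ ^ γ) (nhds 0) (nhds (0 ^ γ)) :=
          (Real.continuousAt_rpow_const 0 γ (Or.inr hγ.le)).tendsto
        rw [Real.zero_rpow hγ.ne'] at h1
        have := (h1.mono_left (nhdsWithin_le_nhds (s := Set.Ioi (0 : ℝ)))).const_mul c₂
        rwa [mul_zero] at this
      have hge : (μ {y | g (Y y) = Q}).toReal ≤ 0 := by
        refine ge_of_tendsto hlim ?_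
        filter_upwards [self_mem_nhdsWithin, mem_nhdsWithin_of_mem_nhds (Iic_mem_nhds hδ₀)]
          with δ h1 h2
        exact hle δ h1 h2
      have := le_antisymm hge ENNReal.toReal_nonneg
      rcases (ENNReal.toReal_eq_zero_iff _).1 this with h | h
      · exact h
      · exact absurd h (measure_ne_top _ _)
    have e : μ {y | g (Y y) = Q} = Measure.map Y μ {t | g t = Q} := by
      rw [Measure.map_apply hY hmQ]; rfl
    rw [e, hlaw, withDensity_apply _ hmQ,
      setLIntegral_congr_fun (g := fun _ => ENNReal.ofReal Q) hmQ
        (fun t ht => by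
          have : g t = Q := ht
          simp only [this]), setLIntegral_const, mul_eq_zero] at h0
    rcases h0 with h0 | h0
    · exact absurd (ENNReal.ofReal_eq_zero.1 h0) (not_le.2 hQ)
    · exact h0

lemma null_of_law {X : Type*} [MeasurableSpace X] (μ : Measure X)
    (Y : X → ℝ) (hY : Measurable Y) (g : ℝ → ℝ)
    (hlaw : Measure.map Y μ = volume.withDensity fun t => ENNReal.ofReal (g t))
    (B : Set ℝ) (hB : MeasurableSet B) (h0 : volume B = 0) : μ {y | Y y ∈ B} = 0 := by
  have e : μ {y | Y y ∈ B} = Measure.map Y μ B := by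
    rw [Measure.map_apply hY hB]; rfl
  rw [e, hlaw]
  exact withDensity_absolutelyContinuous _ _ h0

/-- Theorem 2, consistency of the mixture proportion estimates. Under the
mixture model `f_test = Σ_k π̃_k f_k + ε e`, for a fixed map `η : ℝ^p → ℝ^K` with `g_{l,k}`
the density of `η_l(x)` in class `k`, `S_l = {t : g_{l,l}(t) ≥ Q(ζ; g_{l,l}∘η_l, F_l)}`,
`P_l = P_test(η_l(x) ∈ S_l)`, `𝐏_{l,k} = P_{F_k}(η_l(x) ∈ S_l)` and `Σ = 𝐏ᵀ𝐏`, assume: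
Assumption 3 (each `g_{l,k}` — including the outlier row `k = R` — is bounded and each
`g_{l,l}` is Hölder continuous); Assumption 4 (two-sided `γ`-power behavior of
`P_{F_l}(g_{l,l}(t) ≤ Q(ζ; g_{l,l}∘η_l, F_l) + δ) − ζ`); Assumption 5
(`P_R(η_l(x) ∈ S_l) = 0` and `Σ` invertible with smallest eigenvalue at least `c₀ > 0`).
Then any solutions `π̂` of the empirical least-squares problem `Ĵ(η)` — with empirical
frequencies over estimated level sets `Ŝ_l` built from Gaussian kernel density estimates
with bandwidth `h_n → 0`, `log n/(n h_n) → 0` — satisfy `π̂_k → π̃_k` in probability. -/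
theorem mixestimate_consistency (p K : ℕ)
    (F : Fin K → Measure (Fin p → ℝ)) [∀ k, IsProbabilityMeasure (F k)]
    (PR : Measure (Fin p → ℝ)) [IsProbabilityMeasure PR]
    (f : Fin K → (Fin p → ℝ) → ℝ) (e : (Fin p → ℝ) → ℝ)
    (hfmeas : ∀ k, Measurable (f k)) (hemeas : Measurable e)
    (hf0 : ∀ k x, 0 ≤ f k x) (he0 : ∀ x, 0 ≤ e x)
    (hF : ∀ k, F k = MeasureTheory.volume.withDensity fun x => ENNReal.ofReal (f k x))
    (hPR : PR = MeasureTheory.volume.withDensity fun x => ENNReal.ofReal (e x))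
    (pit : Fin K → ℝ) (ε : ℝ)
    (hpit : ∀ k, pit k ∈ Set.Ico (0 : ℝ) 1) (hε : ε ∈ Set.Ico (0 : ℝ) 1)
    (hsum : (∑ k, pit k) + ε = 1)
    (fTest : (Fin p → ℝ) → ℝ)
    (hTest : ∀ x, fTest x = (∑ k, pit k * f k x) + ε * e x)
    (Ftest : Measure (Fin p → ℝ))
    (hFtest : Ftest = MeasureTheory.volume.withDensity fun x => ENNReal.ofReal (fTest x))
    -- the asymptotic regime
    (nk : ℕ → Fin K → ℕ) (N : ℕ → ℕ) (c : ℝ) (hc : 0 < c)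
    (hN : c ≤ Filter.liminf (fun n : ℕ => (N n : ℝ) / (n : ℝ)) atTop)
    (ck : Fin K → ℝ) (hck : ∀ k, ck k ∈ Set.Ioo (0 : ℝ) 1)
    (hnk : ∀ k, Tendsto (fun n : ℕ => (nk n k : ℝ) / (n : ℝ)) atTop (nhds (ck k)))
    -- the fixed map η and the densities of its coordinates in each class
    (η : (Fin p → ℝ) → Fin K → ℝ) (hη : Measurable η)
    (ζ : ℝ) (hζ : ζ ∈ Set.Ioo (0 : ℝ) 1)
    (g : Fin K → Fin K → ℝ → ℝ) (gR : Fin K → ℝ → ℝ)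
    (hgmeas : ∀ l k, Measurable (g l k)) (hgRmeas : ∀ l, Measurable (gR l))
    (hg : ∀ l k, Measure.map (fun x => η x l) (F k)
      = MeasureTheory.volume.withDensity fun t => ENNReal.ofReal (g l k t))
    (hgR : ∀ l, Measure.map (fun x => η x l) PR
      = MeasureTheory.volume.withDensity fun t => ENNReal.ofReal (gR l t))
    -- the oracle level sets and the oracle regression problem
    (S : Fin K → Set ℝ)
    (hS : ∀ l, S l = {t | lowerQ ζ (fun x => g l l (η x l)) (F l) ≤ g l l t})
    (Pmat : Matrix (Fin K) (Fin K) ℝ)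
    (hPmat : ∀ l k, Pmat l k = ((F k) {x | η x l ∈ S l}).toReal)
    -- Assumption 3
    (Gbd : ℝ) (hgbd : ∀ l k t, g l k t ≤ Gbd) (hgRbd : ∀ l t, gR l t ≤ Gbd)
    (hHolder : ∀ l, ∃ γh ∈ Set.Ioc (0 : ℝ) 1, ∃ BH : ℝ,
      ∀ z z' : ℝ, |g l l z - g l l z'| ≤ BH * |z - z'| ^ γh)
    -- Assumption 4
    (γ c₁ c₂ δ₀ : ℝ) (hγ : 0 < γ) (hc₁ : 0 < c₁) (hc₂ : 0 < c₂) (hδ₀ : 0 < δ₀)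
    (hA4 : ∀ l, ∀ δ : ℝ, |δ| ≤ δ₀ →
      c₁ * |δ| ^ γ ≤ |((F l) {x | g l l (η x l)
          ≤ lowerQ ζ (fun x => g l l (η x l)) (F l) + δ}).toReal - ζ| ∧
        |((F l) {x | g l l (η x l)
          ≤ lowerQ ζ (fun x => g l l (η x l)) (F l) + δ}).toReal - ζ| ≤ c₂ * |δ| ^ γ)
    -- Assumption 5
    (hA5a : ∀ l, PR {x | η x l ∈ S l} = 0)
    (c₀ : ℝ) (hc₀ : 0 < c₀)
    (hA5b : IsUnit (Pmat.transpose * Pmat))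
    (hA5c : ∀ w : Fin K → ℝ,
      c₀ * (∑ i, w i ^ 2) ≤ w ⬝ᵥ ((Pmat.transpose * Pmat).mulVec w))
    -- the bandwidth
    (h : ℕ → ℝ) (hhpos : ∀ n, 0 < h n)
    (hh0 : Tendsto h atTop (nhds 0))
    (hh1 : Tendsto (fun n : ℕ => Real.log n / (n * h n)) atTop (nhds 0))
    -- the random samples: i.i.d. class samples and i.i.d. test samples
    (Ω : Type*) [MeasurableSpace Ω] (P : Measure Ω) [IsProbabilityMeasure P]
    (Xtr : ℕ → Fin K → ℕ → Ω → (Fin p → ℝ)) (Xte : ℕ → ℕ → Ω → (Fin p → ℝ))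
    (hXtrmeas : ∀ n k i, Measurable (Xtr n k i))
    (hXtemeas : ∀ n i, Measurable (Xte n i))
    (hiidtr : ∀ n k, Measure.map (fun ω => fun i : Fin (nk n k) => Xtr n k i ω) P
      = Measure.pi fun _ : Fin (nk n k) => F k)
    (hiidte : ∀ n, Measure.map (fun ω => fun i : Fin (N n) => Xte n i ω) P
      = Measure.pi fun _ : Fin (N n) => Ftest)
    -- the Gaussian kernel density estimates and the estimated level sets
    (ghat : ℕ → Fin K → Ω → ℝ → ℝ)
    (hghat : ∀ n l ω t, ghat n l ω t = (1 / ((nk n l : ℝ) * h n)) *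
      ∑ i : Fin (nk n l),
        Real.exp (-(((t - η (Xtr n l i ω) l) / h n) ^ 2) / 2) / Real.sqrt (2 * Real.pi))
    (Femp : ℕ → Fin K → Ω → Measure (Fin p → ℝ))
    (hFemp : ∀ n l ω, Femp n l ω
      = ((nk n l : ℝ≥0∞))⁻¹ • ∑ i : Fin (nk n l), Measure.dirac (Xtr n l i ω))
    (Shat : ℕ → Fin K → Ω → Set ℝ)
    (hShat : ∀ n l ω, Shat n l ω
      = {t | lowerQ ζ (fun x => ghat n l ω (η x l)) (Femp n l ω) ≤ ghat n l ω t})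
    -- the empirical least-squares problem Ĵ(η) and its solutions π̂
    (Phat : ℕ → Ω → Fin K → ℝ)
    (hPhat : ∀ n ω l, Phat n ω l = (1 / (N n : ℝ)) *
      ∑ i : Fin (N n), if η (Xte n i ω) l ∈ Shat n l ω then (1 : ℝ) else 0)
    (Pmathat : ℕ → Ω → Fin K → Fin K → ℝ)
    (hPmathat : ∀ n ω l k, Pmathat n ω l k = (1 / (nk n k : ℝ)) *
      ∑ i : Fin (nk n k), if η (Xtr n k i ω) l ∈ Shat n l ω then (1 : ℝ) else 0)
    (pihat : ℕ → Ω → Fin K → ℝ)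
    (hmin : ∀ n ω, ∀ w : Fin K → ℝ,
      ∑ l, (Phat n ω l - ∑ k, Pmathat n ω l k * pihat n ω k) ^ 2
        ≤ ∑ l, (Phat n ω l - ∑ k, Pmathat n ω l k * w k) ^ 2) :
    -- conclusion: π̂_k → π̃_k in probability
    ∀ k : Fin K, ∀ ε' : ℝ, 0 < ε' →
      Tendsto (fun n : ℕ => P {ω | ε' < |pihat n ω k - pit k|}) atTop (nhds 0) := by
  classical
  have hηl : ∀ l, Measurable fun x => η x l := fun l => (measurable_pi_apply l).comp hη
  -- the test distribution
  have hFt : ∀ B, MeasurableSet B → Ftest B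
      = ∑ k, ENNReal.ofReal (pit k) * F k B + ENNReal.ofReal ε * PR B := by
    intro B hB
    have e1 : ∀ x, ENNReal.ofReal (fTest x) = (∑ k, ENNReal.ofReal (pit k) * ENNReal.ofReal (f k x))
        + ENNReal.ofReal ε * ENNReal.ofReal (e x) := by
      intro x
      rw [hTest, ENNReal.ofReal_add
        (Finset.sum_nonneg fun k _ => mul_nonneg (hpit k).1 (hf0 k x))
        (mul_nonneg hε.1 (he0 x)),
        ENNReal.ofReal_sum_of_nonneg (fun k _ => mul_nonneg (hpit k).1 (hf0 k x)),
        ENNReal.ofReal_mul hε.1]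
      congr 1
      exact Finset.sum_congr rfl fun k _ => ENNReal.ofReal_mul (hpit k).1
    rw [hFtest, withDensity_apply _ hB]
    simp_rw [e1]
    rw [lintegral_add_right _ (by fun_prop), lintegral_finsetSum _ (fun k _ => by fun_prop),
      lintegral_const_mul _ (by fun_prop), hPR, withDensity_apply _ hB]
    congr 1
    refine Finset.sum_congr rfl fun k _ => ?_
    rw [lintegral_const_mul _ (by fun_prop), hF k, withDensity_apply _ hB]
  haveI hFtprob : IsProbabilityMeasure Ftest := by
    constructor
    rw [hFt _ MeasurableSet.univ]
    simp only [measure_univ, mul_one]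
    rw [← ENNReal.ofReal_sum_of_nonneg (fun k _ => (hpit k).1),
      ← ENNReal.ofReal_add (Finset.sum_nonneg fun k _ => (hpit k).1) hε.1, hsum,
      ENNReal.ofReal_one]
  -- sample sizes
  have hnk1 : ∀ k, ∀ᶠ n : ℕ in atTop, ck k / 2 * (n : ℝ) ≤ nk n k := by
    intro k
    refine ratio_ev (fun n => nk n k) (ck k / 2) ?_
    have : ck k / 2 < ck k := by linarith [(hck k).1]
    filter_upwards [(hnk k).eventually (lt_mem_nhds this)] with n hn using hn.le
  have hckpos : ∀ k, 0 < ck k / 2 := fun k => by linarith [(hck k).1]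
  have hnkt : ∀ k, Tendsto (fun n => nk n k) atTop atTop := fun k =>
    ratio_tendsto _ _ (hckpos k) (hnk1 k)
  have hNt : Tendsto N atTop atTop :=
    ratio_tendsto N (c / 2) (by positivity) (ratio_ev N _ (liminf_ev _ c hc hN))
  -- quantiles
  set Q : Fin K → ℝ := fun l => lowerQ ζ (fun x => g l l (η x l)) (F l) with hQdef
  have hq : ∀ l, _ := fun l => quantile_facts (F l) (fun x => η x l) (hηl l) (g l l) (hgmeas l l)
    (hg l l) (Q l) ζ γ c₁ c₂ δ₀ hζ.1 hγ hc₁ hδ₀ (hA4 l)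
  have hmQ : ∀ l, MeasurableSet {t | g l l t = Q l} := fun l =>
    measurableSet_eq_fun (hgmeas l l) measurable_const
  have hnullF : ∀ l k, F k {x | g l l (η x l) = Q l} = 0 := fun l k =>
    null_of_law (F k) (fun x => η x l) (hηl l) (g l k) (hg l k) _ (hmQ l) (hq l).2.2.2
  have hnullR : ∀ l, PR {x | g l l (η x l) = Q l} = 0 := fun l =>
    null_of_law PR (fun x => η x l) (hηl l) (gR l) (hgR l) _ (hmQ l) (hq l).2.2.2
  have hnullT : ∀ l, Ftest {x | g l l (η x l) = Q l} = 0 := by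
    intro l
    have hm : MeasurableSet {x | g l l (η x l) = Q l} :=
      measurableSet_eq_fun ((hgmeas l l).comp (hηl l)) measurable_const
    rw [hFt _ hm, hnullR]
    simp [hnullF]
  have hSset : ∀ l, {x | η x l ∈ S l} = {x | Q l ≤ g l l (η x l)} := by
    intro l; rw [hS l]; rfl
  have hTestP : ∀ l, (Ftest {x | Q l ≤ g l l (η x l)}).toReal = ∑ k, Pmat l k * pit k := by
    intro l
    have hm : MeasurableSet {x | Q l ≤ g l l (η x l)} :=
      measurableSet_le measurable_const ((hgmeas l l).comp (hηl l))
    rw [hFt _ hm, ← hSset, hA5a,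
      mul_zero, add_zero, ENNReal.toReal_sum
        (fun k _ => ENNReal.mul_ne_top ENNReal.ofReal_ne_top (measure_ne_top _ _))]
    refine Finset.sum_congr rfl fun k _ => ?_
    rw [ENNReal.toReal_mul, ENNReal.toReal_ofReal (hpit k).1, hPmat, mul_comm]
  have hghat' : ∀ n l ω t, ghat n l ω t
      = (1 / (nk n l : ℝ)) * ∑ i : Fin (nk n l), kf (h n) t (η (Xtr n l i ω) l) := by
    intro n l ω t
    rw [hghat]
    unfold kf
    rw [← Finset.mul_sum, ← mul_assoc]
    congr 1
    rw [one_div_mul_one_div]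
  have hShat' : ∀ n l ω, {y | η y l ∈ Shat n l ω} = {y : Fin p → ℝ | sSup {t : ℝ |
      emp (nk n l) (fun i => Xtr n l i ω) {y | ghat n l ω (η y l) ≤ t} ≤ ζ}
        ≤ ghat n l ω (η y l)} := by
    intro n l ω
    rw [hShat, hFemp]
    unfold lowerQ
    simp_rw [femp (nk n l) (fun i => Xtr n l i ω)]
    rfl
  -- convergence of the empirical design and response
  have hdes : ∀ τ : ℝ, 0 < τ → ∀ l k, HP P (fun n => {ω | |Pmathat n ω l k - Pmat l k| ≤ τ}) := by
    intro τ hτ l k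
    obtain ⟨γh, hγh, BH, hBH⟩ := hHolder l
    have := pair P (F l) (fun n => nk n l) _ (hckpos l) (hnk1 l) (hnkt l) (fun n => Xtr n l)
      (fun n i => hXtrmeas n l i) (fun n => hiidtr n l) (F k) (fun n => nk n k) (hnkt k)
      (fun n => Xtr n k) (fun n i => hXtrmeas n k i) (fun n => hiidtr n k) (fun x => η x l) (hηl l)
      (g l l) (hgmeas l l) (hg l l) Gbd (hgbd l l) γh BH hγh hBH h hhpos hh0 hh1
      (fun n ω => ghat n l ω) (fun n ω t => hghat' n l ω t) (Q l) ζ δ₀ (hq l).1 hδ₀ (hq l).2.1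
      (hq l).2.2.1 (hnullF l k) τ hτ
    refine this.mono (Eventually.of_forall fun n ω hω => ?_)
    have hω' := hω
    simp only [Set.mem_ofPred_eq] at hω' ⊢
    rw [← hShat' n l ω, ← hSset, ← hPmat] at hω'
    rw [hPmathat]
    exact hω'
  have hres : ∀ τ : ℝ, 0 < τ → ∀ l,
      HP P (fun n => {ω | |Phat n ω l - ∑ k, Pmat l k * pit k| ≤ τ}) := by
    intro τ hτ l
    obtain ⟨γh, hγh, BH, hBH⟩ := hHolder l
    have := pair P (F l) (fun n => nk n l) _ (hckpos l) (hnk1 l) (hnkt l) (fun n => Xtr n l)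
      (fun n i => hXtrmeas n l i) (fun n => hiidtr n l) Ftest N hNt
      Xte hXtemeas hiidte (fun x => η x l) (hηl l)
      (g l l) (hgmeas l l) (hg l l) Gbd (hgbd l l) γh BH hγh hBH h hhpos hh0 hh1
      (fun n ω => ghat n l ω) (fun n ω t => hghat' n l ω t) (Q l) ζ δ₀ (hq l).1 hδ₀ (hq l).2.1
      (hq l).2.2.1 (hnullT l) τ hτ
    refine this.mono (Eventually.of_forall fun n ω hω => ?_)
    have hω' := hω
    simp only [Set.mem_ofPred_eq] at hω' ⊢
    rw [← hShat' n l ω, hTestP] at hω'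
    rw [hPhat]
    exact hω'
  -- conclusion
  intro k ε' hε'
  obtain ⟨τ, hτ, hτ1, hτ2⟩ : ∃ τ : ℝ, 0 < τ ∧ 2 * K ^ 2 * τ ^ 2 < c₀ / 2 ∧
      8 * K * (1 + K) ^ 2 * τ ^ 2 < c₀ / 2 * ε' ^ 2 := by
    have l1 : Tendsto (fun τ : ℝ => 2 * (K : ℝ) ^ 2 * τ ^ 2) (nhdsWithin 0 (Set.Ioi 0))
        (nhds 0) := by
      have : Tendsto (fun τ : ℝ => 2 * (K : ℝ) ^ 2 * τ ^ 2) (nhds 0)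
          (nhds (2 * (K : ℝ) ^ 2 * 0 ^ 2)) := Continuous.tendsto (by fun_prop) 0
      simp only [ne_eq, OfNat.ofNat_ne_zero, not_false_eq_true, zero_pow, mul_zero] at this
      exact this.mono_left nhdsWithin_le_nhds
    have l2 : Tendsto (fun τ : ℝ => 8 * (K : ℝ) * (1 + K) ^ 2 * τ ^ 2) (nhdsWithin 0 (Set.Ioi 0))
        (nhds 0) := by
      have : Tendsto (fun τ : ℝ => 8 * (K : ℝ) * (1 + K) ^ 2 * τ ^ 2) (nhds 0)
          (nhds (8 * (K : ℝ) * (1 + K) ^ 2 * 0 ^ 2)) := Continuous.tendsto (by fun_prop) 0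
      simp only [ne_eq, OfNat.ofNat_ne_zero, not_false_eq_true, zero_pow, mul_zero] at this
      exact this.mono_left nhdsWithin_le_nhds
    have := ((l1.eventually (gt_mem_nhds (by positivity : 0 < c₀ / 2))).and
      (l2.eventually (gt_mem_nhds (by positivity : 0 < c₀ / 2 * ε' ^ 2)))).and
      (self_mem_nhdsWithin : Set.Ioi (0 : ℝ) ∈ nhdsWithin (0 : ℝ) (Set.Ioi 0))
    obtain ⟨τ, ⟨h1, h2⟩, h3⟩ := this.exists
    exact ⟨τ, h3, h1, h2⟩
  have hall := (HP.all fun l => HP.all fun k => hdes τ hτ l k).inter (HP.all fun l => hres τ hτ l)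
  have hfin : HP P (fun n => {ω | ε' < |pihat n ω k - pit k|}ᶜ) := by
    refine hall.mono (Eventually.of_forall fun n => ?_)
    rintro ω ⟨hω1, hω2⟩
    simp only [Set.mem_iInter, Set.mem_ofPred_eq] at hω1 hω2
    have hl := ls K Pmat (Pmathat n ω) (Phat n ω) pit (pihat n ω) c₀ τ
      (by
        intro w
        refine (hA5c w).trans (le_of_eq ?_)
        rw [← Matrix.mulVec_mulVec, Matrix.dotProduct_mulVec, Matrix.vecMul_transpose]
        simp only [dotProduct, Matrix.mulVec, sq])
      hω1 hτ.le hω2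
      (fun j => by rw [abs_of_nonneg (hpit j).1]; exact (hpit j).2.le) (hmin n ω pit)
    simp only [Set.mem_compl_iff, Set.mem_ofPred_eq, not_lt]
    have hk : (pihat n ω k - pit k) ^ 2 ≤ ∑ i, (pihat n ω i - pit i) ^ 2 :=
      Finset.single_le_sum (f := fun i => (pihat n ω i - pit i) ^ 2)
        (fun i _ => sq_nonneg _) (Finset.mem_univ k)
    refine abs_le_of_sq_le_sq ?_ hε'.le
    by_contra hcon
    push Not at hcon
    have hs : ε' ^ 2 < ∑ i, (pihat n ω i - pit i) ^ 2 := hcon.trans_le hk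
    have h1 : c₀ / 2 * ∑ i, (pihat n ω i - pit i) ^ 2
        ≤ (c₀ - 2 * K ^ 2 * τ ^ 2) * ∑ i, (pihat n ω i - pit i) ^ 2 :=
      mul_le_mul_of_nonneg_right (by linarith) (by positivity)
    have h2 : c₀ / 2 * ε' ^ 2 < c₀ / 2 * ∑ i, (pihat n ω i - pit i) ^ 2 :=
      mul_lt_mul_of_pos_left hs (by positivity)
    linarith
  unfold HP at hfin
  simpa only [compl_compl] using hfin
end

section
/- Suppose f_test(x) = Σ_{k=1}^K π̃_k f_k(x) + ε·e(x) with Σ_k π̃_k + ε = 1, and let S_1, …, S_K ⊆ ℝ be measurable sets and η : ℝ^p → ℝ^K a measurable map such that P_R(η_l(x) ∈ S_l) = 0 for all l = 1,…,K. Then (i) P_{test}(η_l(x) ∈ S_l) = Σ_{k=1}^K π̃_k P_{F_k}(η_l(x) ∈ S_l) for each l; and (ii) writing P_l = P_{test}(η_l(x) ∈ S_l) and 𝐏_{l,k} = P_{F_k}(η_l(x) ∈ S_l), if 𝐏ᵀ𝐏 is invertible then π̃ = (π̃_1,…,π̃_K) is the unique minimizer over π ∈ ℝ^K of ‖P − 𝐏π‖²_2,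 and π̃ = (𝐏ᵀ𝐏)^{-1}𝐏ᵀP. -/
open MeasureTheory Matrix

/-- under the mixture model `f_test = Σ_k π̃_k f_k + ε e`, if the outlier
class puts no mass on the regions `{η_l(x) ∈ S_l}`, then (i) the test probabilities of
these regions are the mixture of the class probabilities, and (ii) with response
`P_l = P_test(η_l(x) ∈ S_l)` and design `𝐏_{l,k} = P_{F_k}(η_l(x) ∈ S_l)`, if `𝐏ᵀ𝐏` is
invertible then `π̃` is the unique minimizer of `‖P − 𝐏π‖²` and `π̃ = (𝐏ᵀ𝐏)⁻¹𝐏ᵀP`. -/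
theorem mixture_regression_identity (p K : ℕ)
    (F : Fin K → Measure (Fin p → ℝ)) [∀ k, IsProbabilityMeasure (F k)]
    (PR Ptest : Measure (Fin p → ℝ))
    (f : Fin K → (Fin p → ℝ) → ℝ) (e : (Fin p → ℝ) → ℝ)
    (hfmeas : ∀ k, Measurable (f k)) (hemeas : Measurable e)
    (hf0 : ∀ k x, 0 ≤ f k x) (he0 : ∀ x, 0 ≤ e x)
    (hF : ∀ k, F k = MeasureTheory.volume.withDensity fun x => ENNReal.ofReal (f k x))
    (hPR : PR = MeasureTheory.volume.withDensity fun x => ENNReal.ofReal (e x))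
    (pit : Fin K → ℝ) (ε : ℝ)
    (hpit : ∀ k, pit k ∈ Set.Ico (0 : ℝ) 1) (hε : ε ∈ Set.Ico (0 : ℝ) 1)
    (hsum : (∑ k, pit k) + ε = 1)
    (fTest : (Fin p → ℝ) → ℝ)
    (hTest : ∀ x, fTest x = (∑ k, pit k * f k x) + ε * e x)
    (hPtest : Ptest = MeasureTheory.volume.withDensity fun x => ENNReal.ofReal (fTest x))
    (η : (Fin p → ℝ) → Fin K → ℝ) (hη : Measurable η)
    (S : Fin K → Set ℝ) (hS : ∀ l, MeasurableSet (S l))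
    (houtlier : ∀ l, PR {x | η x l ∈ S l} = 0)
    (Pvec : Fin K → ℝ) (hPvec : ∀ l, Pvec l = (Ptest {x | η x l ∈ S l}).toReal)
    (Pmat : Matrix (Fin K) (Fin K) ℝ)
    (hPmat : ∀ l k, Pmat l k = ((F k) {x | η x l ∈ S l}).toReal) :
    (∀ l, Pvec l = ∑ k, pit k * Pmat l k) ∧
      (IsUnit (Pmat.transpose * Pmat) →
        (∀ w : Fin K → ℝ,
          ∑ l, (Pvec l - ∑ k, Pmat l k * pit k) ^ 2
            ≤ ∑ l, (Pvec l - ∑ k, Pmat l k * w k) ^ 2) ∧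
        (∀ w : Fin K → ℝ, w ≠ pit →
          ∑ l, (Pvec l - ∑ k, Pmat l k * pit k) ^ 2
            < ∑ l, (Pvec l - ∑ k, Pmat l k * w k) ^ 2) ∧
        ((Pmat.transpose * Pmat)⁻¹ * Pmat.transpose).mulVec Pvec = pit) := by
  have h1 : ∀ l, Pvec l = ∑ k, pit k * Pmat l k := by
    intro l
    have hA : MeasurableSet {x | η x l ∈ S l} :=
      ((measurable_pi_apply l).comp hη) (hS l)
    have key : Ptest {x | η x l ∈ S l}
        = ∑ k, ENNReal.ofReal (pit k) * F k {x | η x l ∈ S l} := by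
      have hfun : ∀ x, ENNReal.ofReal (fTest x)
          = (∑ k, ENNReal.ofReal (pit k) * ENNReal.ofReal (f k x))
            + ENNReal.ofReal ε * ENNReal.ofReal (e x) := by
        intro x
        rw [hTest, ENNReal.ofReal_add
          (Finset.sum_nonneg fun k _ => mul_nonneg (hpit k).1 (hf0 k x))
          (mul_nonneg hε.1 (he0 x)),
          ENNReal.ofReal_sum_of_nonneg (fun k _ => mul_nonneg (hpit k).1 (hf0 k x)),
          ENNReal.ofReal_mul hε.1]
        congr 1
        exact Finset.sum_congr rfl fun k _ => ENNReal.ofReal_mul (hpit k).1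
      have h0 := houtlier l
      rw [hPR, withDensity_apply _ hA] at h0
      rw [hPtest, withDensity_apply _ hA]
      simp_rw [hfun]
      rw [lintegral_add_right _ (hemeas.ennreal_ofReal.const_mul _),
        lintegral_const_mul _ hemeas.ennreal_ofReal, h0, mul_zero, add_zero,
        lintegral_finsetSum _ (fun k _ => (hfmeas k).ennreal_ofReal.const_mul _)]
      refine Finset.sum_congr rfl fun k _ => ?_
      rw [lintegral_const_mul _ (hfmeas k).ennreal_ofReal, hF k, withDensity_apply _ hA]
    rw [hPvec, key, ENNReal.toReal_sum
      (fun k _ => ENNReal.mul_ne_top ENNReal.ofReal_ne_top (measure_ne_top _ _))]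
    refine Finset.sum_congr rfl fun k _ => ?_
    rw [ENNReal.toReal_mul, ENNReal.toReal_ofReal (hpit k).1, hPmat]
  have h2 : ∀ l, Pvec l - ∑ k, Pmat l k * pit k = 0 := by
    intro l
    rw [h1 l, sub_eq_zero]
    exact Finset.sum_congr rfl fun k _ => mul_comm _ _
  have h3 : Pvec = Pmat.mulVec pit := by
    funext l
    exact sub_eq_zero.mp (h2 l)
  refine ⟨h1, fun hU => ?_⟩
  have hdet := (Matrix.isUnit_iff_isUnit_det _).mp hU
  have h4 : ∀ w : Fin K → ℝ,
      ((Pmat.transpose * Pmat)⁻¹ * Pmat.transpose).mulVec (Pmat.mulVec w) = w := by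
    intro w
    rw [Matrix.mulVec_mulVec, Matrix.mul_assoc, Matrix.nonsing_inv_mul _ hdet,
      Matrix.one_mulVec]
  have hz : ∑ l, (Pvec l - ∑ k, Pmat l k * pit k) ^ 2 = 0 := by
    simp [h2]
  rw [hz]
  refine ⟨fun w => Finset.sum_nonneg fun l _ => sq_nonneg _, fun w hw => ?_, ?_⟩
  · refine lt_of_le_of_ne (Finset.sum_nonneg fun l _ => sq_nonneg _) fun h => hw ?_
    have h5 := (Finset.sum_eq_zero_iff_of_nonneg (fun l _ => sq_nonneg _)).mp h.symm
    have h6 : Pvec = Pmat.mulVec w := by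
      funext l
      exact sub_eq_zero.mp (pow_eq_zero_iff two_ne_zero |>.mp (h5 l (Finset.mem_univ l)))
    rw [← h4 w, ← h6, h3, h4]
  · rw [h3, h4]
end
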